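/- arXiv:2505.06550 — 2 statements merged into one kernel-verified Lean document; each statement's English description precedes it below -/
import Mathlib

section
/- Let k ∈ ℕ, let G = K_{2k+2}^{(2)}, and let X ⊆ V(G) be the set of the 2k + 2 branch vertices of G. Then: (i) any two distinct vertices of X are at distance exactly 3 in G, so every closed ball of radius 1 in G contains at most one vertex of X; and (ii) for every set Ŝ ⊆ V(G) with |Ŝ| ≤ k, setting S = N[Ŝ], all vertices of X \ S lie in a single connected component of G − S, and |X \ S| ≥ k + 2. -/
open SimpleGraph
open scoped ENNReal NNReal

/-- The set of vertices of `G` at graph-distance at most `r` from the set `S`. -/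
def ballAround {V : Type*} (G : SimpleGraph V) (S : Set V) (r : ℕ) : Set V :=
  {v | ∃ u ∈ S, G.edist u v ≤ (r : ℕ∞)}

/-- A set `S` is `(k, r)`-centred in `G` if it is contained in the union of the balls of
radius `r` around at most `k` vertices. -/
def IsCentred {V : Type*} (G : SimpleGraph V) (k r : ℕ) (S : Set V) : Prop :=
  ∃ T : Set V, T.ncard ≤ k ∧ S ⊆ ballAround G T r

/-- `S` is a balanced separator for the weight function `μ`: every connected component of
`G - S` carries at most half of the total weight. -/
def IsBalancedSeparator {V : Type*} (G : SimpleGraph V) (μ : V → NNReal) (S : Set V) : Prop :=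
  ∀ C : (G.induce Sᶜ).ConnectedComponent,
    (∑ᶠ v ∈ C.supp, μ (v : V)) ≤ (∑ᶠ v : V, μ v) / 2

/-- `G` admits `(k, r)`-balanced separators: for every weight function there is a
`(k, r)`-centred balanced separator. -/
def AdmitsBalancedSeparators {V : Type*} (G : SimpleGraph V) (k r : ℕ) : Prop :=
  ∀ μ : V → NNReal, ∃ S : Set V, IsCentred G k r S ∧ IsBalancedSeparator G μ S

/-- A tree-decomposition of `G` with nodes indexed by `τ`. -/
structure TreeDecomp {V : Type*} (G : SimpleGraph V) (τ : Type*) where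
  tree : SimpleGraph τ
  isTree : tree.IsTree
  bag : τ → Set V
  covers_edge : ∀ ⦃u w : V⦄, G.Adj u w → ∃ x : τ, u ∈ bag x ∧ w ∈ bag x
  covers_vertex : ∀ v : V, ∃ x : τ, v ∈ bag x
  bags_connected : ∀ v : V, (tree.induce {x : τ | v ∈ bag x}).Connected

/-- `G` has a tree-decomposition of width at most `w`. -/
def HasTreeDecompOfWidth {V : Type*} (G : SimpleGraph V) (w : ℕ) : Prop :=
  ∃ (τ : Type) (_ : Fintype τ) (D : TreeDecomp G τ), ∀ x : τ, (D.bag x).ncard ≤ w + 1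

/-- The treewidth of `G`. -/
noncomputable def treewidth {V : Type*} (G : SimpleGraph V) : ℕ :=
  sInf {w : ℕ | HasTreeDecompOfWidth G w}

/-- The separation number of `G`. -/
noncomputable def sepNum {V : Type*} (G : SimpleGraph V) : ℕ :=
  sInf {m : ℕ | ∀ μ : V → NNReal, ∃ S : Set V, S.ncard ≤ m ∧ IsBalancedSeparator G μ S}

/-- `φ` is a `q`-quasi-isometry from `G` to `H`. -/
def IsQuasiIsometry {V W : Type*} (q : ℕ) (G : SimpleGraph V) (H : SimpleGraph W)
    (φ : V → W) : Prop :=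
  (∀ u v : V,
      (q : ℝ≥0∞)⁻¹ * (G.edist u v : ℝ≥0∞) - (q : ℝ≥0∞) ≤ (H.edist (φ u) (φ v) : ℝ≥0∞) ∧
      (H.edist (φ u) (φ v) : ℝ≥0∞) ≤ (q : ℝ≥0∞) * (G.edist u v : ℝ≥0∞) + (q : ℝ≥0∞)) ∧
  ∀ x : W, ∃ v : V, H.edist x (φ v) ≤ (q : ℕ∞)

/-- The 2-subdivision of a graph `H`: each edge is replaced by a path of length 3.
The internal vertex `Sum.inr ⟨(a, b), _⟩` is the subdivision vertex on the edge `ab`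
that is adjacent to `a`. -/
def twoSubdivision {V : Type*} (H : SimpleGraph V) :
    SimpleGraph (V ⊕ {p : V × V // H.Adj p.1 p.2}) :=
  SimpleGraph.fromRel fun a b =>
    match a, b with
    | Sum.inl x, Sum.inr p => x = p.1.1
    | Sum.inr p, Sum.inr q => p.1.1 = q.1.2 ∧ p.1.2 = q.1.1
    | _, _ => False

/-- The largest size of an independent set of `G` contained in `Y`. -/
noncomputable def indepNumOn {V : Type*} (G : SimpleGraph V) (Y : Set V) : ℕ :=
  sSup {n : ℕ | ∃ s ⊆ Y, s.ncard = n ∧ s.Pairwise fun u v => ¬ G.Adj u v}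

/-- The vertex type of the 2-subdivision of the complete graph on `Fin n`. -/
abbrev SubKVert (n : ℕ) : Type :=
  Fin n ⊕ {p : Fin n × Fin n // (⊤ : SimpleGraph (Fin n)).Adj p.1 p.2}

/-- The 2-subdivision of the complete graph on `n` vertices. -/
def subK (n : ℕ) : SimpleGraph (SubKVert n) :=
  twoSubdivision (⊤ : SimpleGraph (Fin n))

/-- The branch (original, high-degree) vertices of the 2-subdivision of `K_n`. -/
def branchSet (n : ℕ) : Set (SubKVert n) := Set.range Sum.inl

section TwoSubdivision

variable {V : Type*} {H : SimpleGraph V}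

@[simp]
lemma twoSubdivision_adj_inl_inl (x y : V) :
    ¬ (twoSubdivision H).Adj (Sum.inl x) (Sum.inl y) := by
  simp [twoSubdivision]

@[simp]
lemma twoSubdivision_adj_inl_inr (x : V) (p : {p : V × V // H.Adj p.1 p.2}) :
    (twoSubdivision H).Adj (Sum.inl x) (Sum.inr p) ↔ x = p.1.1 := by
  simp [twoSubdivision]

@[simp]
lemma twoSubdivision_adj_inr_inl (x : V) (p : {p : V × V // H.Adj p.1 p.2}) :
    (twoSubdivision H).Adj (Sum.inr p) (Sum.inl x) ↔ x = p.1.1 := by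
  rw [SimpleGraph.adj_comm, twoSubdivision_adj_inl_inr]

@[simp]
lemma twoSubdivision_adj_inr_inr (p q : {p : V × V // H.Adj p.1 p.2}) :
    (twoSubdivision H).Adj (Sum.inr p) (Sum.inr q) ↔ p.1.1 = q.1.2 ∧ p.1.2 = q.1.1 := by
  simp only [twoSubdivision, SimpleGraph.fromRel_adj]
  constructor
  · rintro ⟨-, h | h⟩
    exacts [h, ⟨h.2.symm, h.1.symm⟩]
  · refine fun h => ⟨?_, Or.inl h⟩
    intro heq
    obtain rfl := Sum.inr_injective heq
    exact p.2.ne h.1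

/-- The branch vertex whose closed neighbourhood contains a given vertex. -/
def nearestBranch : V ⊕ {p : V × V // H.Adj p.1 p.2} → V :=
  Sum.elim id fun p => p.1.1

lemma edist_twoSubdivision_inl_le_one_iff (v : V ⊕ {p : V × V // H.Adj p.1 p.2}) (x : V) :
    (twoSubdivision H).edist v (Sum.inl x) ≤ 1 ↔ nearestBranch v = x := by
  rw [SimpleGraph.edist_le_one_iff_adj_or_eq]
  rcases v with y | p
  · simp [nearestBranch]
  · simp [nearestBranch, eq_comm]

lemma three_le_length_of_walk_inl_inl {x y : V} (hxy : x ≠ y)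
    (w : (twoSubdivision H).Walk (Sum.inl x) (Sum.inl y)) : 3 ≤ w.length := by
  cases w with
  | nil => exact absurd rfl hxy
  | @cons _ u _ h w =>
    cases w with
    | nil => simp at h
    | cons h' w =>
      cases w with
      | nil =>
        rcases u with z | p
        · simp at h
        · rw [twoSubdivision_adj_inl_inr] at h
          rw [twoSubdivision_adj_inr_inl] at h'
          exact absurd (h.trans h'.symm) hxy
      | cons h'' w => simp

lemma edist_twoSubdivision_of_adj {x y : V} (h : H.Adj x y) :
    (twoSubdivision H).edist (Sum.inl x) (Sum.inl y) = 3 := by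
  refine le_antisymm ?_ (le_iInf fun w => ?_)
  · have h₁ : (twoSubdivision H).Adj (Sum.inl x) (Sum.inr ⟨(x, y), h⟩) := by simp
    have h₂ : (twoSubdivision H).Adj (Sum.inr ⟨(x, y), h⟩) (Sum.inr ⟨(y, x), h.symm⟩) := by simp
    have h₃ : (twoSubdivision H).Adj (Sum.inr ⟨(y, x), h.symm⟩) (Sum.inl y) := by simp
    exact SimpleGraph.edist_le (.cons h₁ (.cons h₂ (.cons h₃ .nil)))
  · exact_mod_cast three_le_length_of_walk_inl_inl h.ne w

lemma inl_mem_ballAround_iff (S : Set (V ⊕ {p : V × V // H.Adj p.1 p.2})) (x : V) :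
    Sum.inl x ∈ ballAround (twoSubdivision H) S 1 ↔ x ∈ nearestBranch '' S := by
  simp only [ballAround, Set.mem_ofPred_eq, Nat.cast_one, edist_twoSubdivision_inl_le_one_iff,
    Set.mem_image]

/-- If a subdivision vertex is dominated by `S`, then so is an end of the subdivided edge. -/
lemma inl_mem_ballAround_of_inr_mem {S : Set (V ⊕ {p : V × V // H.Adj p.1 p.2})}
    {p : {p : V × V // H.Adj p.1 p.2}}
    (hp : Sum.inr p ∈ ballAround (twoSubdivision H) S 1) :
    Sum.inl p.1.1 ∈ ballAround (twoSubdivision H) S 1 ∨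
      Sum.inl p.1.2 ∈ ballAround (twoSubdivision H) S 1 := by
  simp only [inl_mem_ballAround_iff]
  obtain ⟨u, hu, hup⟩ := hp
  rw [Nat.cast_one, SimpleGraph.edist_le_one_iff_adj_or_eq] at hup
  rcases hup with hup | rfl
  · rcases u with z | q
    · rw [twoSubdivision_adj_inl_inr] at hup
      exact Or.inl ⟨_, hu, hup⟩
    · rw [twoSubdivision_adj_inr_inr] at hup
      exact Or.inr ⟨_, hu, hup.1⟩
  · exact Or.inl ⟨_, hu, rfl⟩

lemma reachable_induce_compl_ballAround {S : Set (V ⊕ {p : V × V // H.Adj p.1 p.2})} {x y : V}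
    (h : H.Adj x y) (hx : Sum.inl x ∈ (ballAround (twoSubdivision H) S 1)ᶜ)
    (hy : Sum.inl y ∈ (ballAround (twoSubdivision H) S 1)ᶜ) :
    ((twoSubdivision H).induce (ballAround (twoSubdivision H) S 1)ᶜ).Reachable
      ⟨Sum.inl x, hx⟩ ⟨Sum.inl y, hy⟩ := by
  have hxy : Sum.inr ⟨(x, y), h⟩ ∈ (ballAround (twoSubdivision H) S 1)ᶜ := fun hm =>
    (inl_mem_ballAround_of_inr_mem hm).elim hx hy
  have hyx : Sum.inr ⟨(y, x), h.symm⟩ ∈ (ballAround (twoSubdivision H) S 1)ᶜ := fun hm =>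
    (inl_mem_ballAround_of_inr_mem hm).elim hy hx
  have h₁ : ((twoSubdivision H).induce (ballAround (twoSubdivision H) S 1)ᶜ).Adj
      ⟨Sum.inl x, hx⟩ ⟨_, hxy⟩ := by simp
  have h₂ : ((twoSubdivision H).induce (ballAround (twoSubdivision H) S 1)ᶜ).Adj
      ⟨_, hxy⟩ ⟨_, hyx⟩ := by simp
  have h₃ : ((twoSubdivision H).induce (ballAround (twoSubdivision H) S 1)ᶜ).Adj
      ⟨_, hyx⟩ ⟨Sum.inl y, hy⟩ := by simp
  exact h₁.reachable.trans (h₂.reachable.trans h₃.reachable)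

end TwoSubdivision

lemma le_ncard_branchSet_diff_ballAround (n : ℕ) (S : Set (SubKVert n)) :
    n - S.ncard ≤ (branchSet n \ ballAround (subK n) S 1).ncard := by
  have himage : branchSet n \ ballAround (subK n) S 1 =
      Sum.inl '' (nearestBranch '' S)ᶜ := by
    ext v
    constructor
    · rintro ⟨⟨x, rfl⟩, hx⟩
      exact ⟨x, fun h => hx ((inl_mem_ballAround_iff S x).2 h), rfl⟩
    · rintro ⟨x, hx, rfl⟩
      exact ⟨⟨x, rfl⟩, fun h => hx ((inl_mem_ballAround_iff S x).1 h)⟩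
  rw [himage, Set.ncard_image_of_injective _ Sum.inl_injective]
  have hle : (nearestBranch '' S).ncard ≤ S.ncard := Set.ncard_image_le S.toFinite
  have hadd := Set.ncard_add_ncard_compl (nearestBranch '' S)
  rw [Nat.card_fin] at hadd
  omega

/-- Structure of the branch vertices of the 2-subdivision of `K_{2k+2}`: distinct branch
vertices are at distance exactly `3`, every ball of radius `1` contains at most one branch
vertex, and for every set `Ŝ` of at most `k` vertices with `S = N[Ŝ]`, all branch vertices
outside `S` lie in one component of `G - S` and there are at least `k + 2` of them. -/
theorem subK_branch_vertices (k : ℕ) :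
    (∀ x y : Fin (2 * k + 2), x ≠ y →
      (subK (2 * k + 2)).edist (Sum.inl x) (Sum.inl y) = 3) ∧
    (∀ v : SubKVert (2 * k + 2),
      {u : SubKVert (2 * k + 2) |
        u ∈ branchSet (2 * k + 2) ∧ (subK (2 * k + 2)).edist v u ≤ 1}.Subsingleton) ∧
    (∀ S₀ : Set (SubKVert (2 * k + 2)), S₀.ncard ≤ k →
      (∀ a b : ↥(ballAround (subK (2 * k + 2)) S₀ 1)ᶜ,
          (a : SubKVert (2 * k + 2)) ∈ branchSet (2 * k + 2) →
          (b : SubKVert (2 * k + 2)) ∈ branchSet (2 * k + 2) →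
          ((subK (2 * k + 2)).induce (ballAround (subK (2 * k + 2)) S₀ 1)ᶜ).Reachable a b) ∧
      k + 2 ≤ (branchSet (2 * k + 2) \ ballAround (subK (2 * k + 2)) S₀ 1).ncard) := by
  refine ⟨fun x y hxy => edist_twoSubdivision_of_adj hxy, ?_, fun S₀ hS₀ => ⟨?_, ?_⟩⟩
  · rintro v _ ⟨⟨x, rfl⟩, hx⟩ _ ⟨⟨y, rfl⟩, hy⟩
    exact congrArg Sum.inl (((edist_twoSubdivision_inl_le_one_iff v x).1 hx).symm.trans
      ((edist_twoSubdivision_inl_le_one_iff v y).1 hy))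
  · rintro ⟨_, ha⟩ ⟨_, hb⟩ ⟨x, rfl⟩ ⟨y, rfl⟩
    by_cases hxy : x = y
    · subst hxy
      exact SimpleGraph.Reachable.refl _
    · exact reachable_induce_compl_ballAround hxy ha hb
  · have := le_ncard_branchSet_diff_ballAround (2 * k + 2) S₀
    omega
end

section
/- Let k, t ∈ ℕ and define d = (512·20k)^{(2k+2)^{2t}}. Let G be a finite simple K_{t,t}-free graph such that every induced subgraph of G admits (k, 1)-balanced separators. Then for every X ⊆ V(G) with α(X) ≤ 10dk, there exists a (20dk, 2)-centred tree-decomposition of G that has a bag containing N[X]. -/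
open SimpleGraph
open scoped ENNReal NNReal

/-- The real-valued indicator of a proposition. -/
noncomputable def propInd (p : Prop) : ℝ := open Classical in if p then 1 else 0

lemma propInd_of {p : Prop} (h : p) : propInd p = 1 := by simp [propInd, h]

lemma propInd_of_not {p : Prop} (h : ¬ p) : propInd p = 0 := by simp [propInd, h]

lemma propInd_nonneg (p : Prop) : 0 ≤ propInd p := by
  by_cases h : p <;> simp [propInd, h]

lemma propInd_or_le (p q : Prop) : propInd (p ∨ q) ≤ propInd p + propInd q := by
  by_cases h : p <;> by_cases h' : q <;> simp [propInd, h, h']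

open Finset in
lemma pow_sum_le_card_pow_mul_sum_pow {ι : Type*} [Fintype ι] (f : ι → ℝ) (hf : ∀ i, 0 ≤ f i)
    (r : ℕ) : (∑ i, f i) ^ (r + 1) ≤ (Fintype.card ι : ℝ) ^ r * ∑ i, f i ^ (r + 1) := by
  rcases isEmpty_or_nonempty ι with h | h
  · simp
  have hι : 0 < Fintype.card ι := Fintype.card_pos
  have := pow_sum_div_card_le_sum_pow (s := (univ : Finset ι)) (f := f) (fun i _ => hf i) r
  rw [div_le_iff₀ (by rw [card_univ]; positivity)] at this
  rw [mul_comm]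
  simpa [card_univ] using this

open Finset in
/-- Averaging a function of two distinct coordinates over all tuples. -/
lemma sum_pair_coordinates {A : Type*} [Fintype A] {s : ℕ} {i i' : Fin s} (hi : i ≠ i')
    (g : A → A → ℝ) :
    (∑ f : Fin s → A, g (f i) (f i')) * (Fintype.card A : ℝ) ^ 2 =
      (Fintype.card A : ℝ) ^ s * ∑ x, ∑ y, g x y := by
  classical
  obtain ⟨m, rfl⟩ : ∃ m, s = m + 1 := ⟨s - 1, by have := i.2; omega⟩
  obtain ⟨l, rfl⟩ := Fin.exists_succAbove_eq hi.symm
  obtain ⟨r, rfl⟩ : ∃ r, m = r + 1 := ⟨m - 1, by have := l.2; omega⟩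
  rw [← (Fin.insertNthEquiv (fun _ => A) i).sum_comp, Fintype.sum_prod_type]
  have h1 : ∀ x : A, ∑ f : Fin (r + 1) → A, g x (f l) = (Fintype.card A : ℝ) ^ r * ∑ y, g x y := by
    intro x
    rw [← (Fin.insertNthEquiv (fun _ => A) l).sum_comp, Fintype.sum_prod_type]
    simp [Fin.insertNthEquiv, Finset.mul_sum]
  simp only [Fin.insertNthEquiv, Equiv.coe_fn_mk, Fin.insertNth_apply_same,
    Fin.insertNth_apply_succAbove, h1, ← Finset.mul_sum]
  ring

open Finset in
/-- The Kővári–Sós–Turán bound, for a relation between two finite types. -/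
lemma card_rel_mul_le_of_no_biclique {P S : Type*} [Fintype P] [Fintype S] (Q : P → S → Prop)
    {t M : ℕ} (ht : 1 ≤ t) (hM : 0 < M)
    (hP : M ^ t * t ^ 2 ≤ Fintype.card P) (hS : M ^ t * t ^ 2 ≤ Fintype.card S)
    (hQ : ¬ ∃ (x : Fin t → P) (y : Fin t → S), Function.Injective x ∧ Function.Injective y ∧
      ∀ i j, Q (x i) (y j)) :
    (M : ℝ) * ∑ x, ∑ y, propInd (Q x y) ≤ Fintype.card P * Fintype.card S := by
  classical
  obtain ⟨r, rfl⟩ : ∃ r, t = r + 1 := ⟨t - 1, by omega⟩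
  set q : ℝ := (Fintype.card S : ℝ) with hq
  set p : ℝ := (Fintype.card P : ℝ) with hp
  have hMt : 0 < M ^ (r + 1) * (r + 1) ^ 2 := by positivity
  have hp0 : 0 < p := by rw [hp]; exact_mod_cast lt_of_lt_of_le hMt hP
  have hq0 : 0 < q := by rw [hq]; exact_mod_cast lt_of_lt_of_le hMt hS
  let Qf : P → S → ℝ := fun x y => propInd (Q x y)
  set e : ℝ := ∑ y, ∑ x, Qf x y with he
  have hQf : ∀ x y, 0 ≤ Qf x y := fun x y => propInd_nonneg _
  have he0 : 0 ≤ e := sum_nonneg fun y _ => sum_nonneg fun x _ => hQf x y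
  rw [sum_comm]
  have h1 : e ^ (r + 1) ≤ q ^ r * ∑ y, (∑ x, Qf x y) ^ (r + 1) :=
    pow_sum_le_card_pow_mul_sum_pow _
      (fun y => sum_nonneg fun x _ => hQf x y) r
  have h2 : ∑ y, (∑ x, Qf x y) ^ (r + 1) = ∑ f : Fin (r + 1) → P, ∑ y, ∏ i, Qf (f i) y := by
    simp_rw [Fintype.sum_pow]
    rw [sum_comm]
  have h3 : ∀ f : Fin (r + 1) → P, ∑ y, ∏ i, Qf (f i) y ≤
      r + ∑ ij ∈ (univ : Finset (Fin (r + 1))).offDiag, (if f ij.1 = f ij.2 then q else 0) := by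
    intro f
    have hprod : ∀ y, ∏ i, Qf (f i) y = if ∀ i, Q (f i) y then 1 else 0 := by
      intro y
      simp only [Qf, propInd]
      rw [prod_ite_zero]
      simp
    simp_rw [hprod]
    have hpos : ∀ ij ∈ (univ : Finset (Fin (r + 1))).offDiag,
        0 ≤ (if f ij.1 = f ij.2 then q else 0) := by
      intro ij _; split_ifs <;> positivity
    by_cases hf : Function.Injective f
    · have : ∑ y : S, (if ∀ i, Q (f i) y then (1 : ℝ) else 0) ≤ r := by
        rw [← Finset.sum_filter, sum_const, nsmul_eq_mul, mul_one]
        by_contra hcon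
        push Not at hcon
        have hcon' : r + 1 ≤ #{y : S | ∀ i, Q (f i) y} := by exact_mod_cast hcon
        obtain ⟨u, hu, huc⟩ := Finset.exists_subset_card_eq hcon'
        refine hQ ⟨f, fun j => (u.equivFinOfCardEq huc).symm j, hf,
          fun a b hab => by simpa using hab, fun i j => ?_⟩
        have := hu ((u.equivFinOfCardEq huc).symm j).2
        simp only [mem_filter, mem_univ, true_and] at this
        exact this i
      have := sum_nonneg hpos
      linarith
    · rw [Function.not_injective_iff] at hf
      obtain ⟨a, b, hab, hne⟩ := hf
      have h4 : q ≤ ∑ ij ∈ (univ : Finset (Fin (r + 1))).offDiag,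
          (if f ij.1 = f ij.2 then q else 0) := by
        have := single_le_sum hpos (a := (a, b)) (by simpa using hne)
        simpa [hab] using this
      have h5 : ∑ y : S, (if ∀ i, Q (f i) y then (1 : ℝ) else 0) ≤ q := by
        calc _ ≤ ∑ y : S, (1 : ℝ) := sum_le_sum fun y _ => by split_ifs <;> simp
          _ = q := by simp [hq]
      have : (0 : ℝ) ≤ r := by positivity
      linarith
  have h6 : ∀ ij ∈ (univ : Finset (Fin (r + 1))).offDiag,
      ∑ f : Fin (r + 1) → P, (if f ij.1 = f ij.2 then q else 0) = p ^ (r + 1) * q / p := by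
    intro ij hij
    have := sum_pair_coordinates (A := P) (s := r + 1) (by simpa using hij : ij.1 ≠ ij.2)
      (fun x y => if x = y then q else 0)
    simp only [sum_ite_eq, mem_univ, if_true, sum_const, card_univ, nsmul_eq_mul] at this
    rw [← hp] at this
    field_simp
    nlinarith
  have h7 : ∑ f : Fin (r + 1) → P, ∑ y, ∏ i, Qf (f i) y ≤
      p ^ (r + 1) * r + ((r + 1) ^ 2 - (r + 1)) * (p ^ (r + 1) * q / p) := by
    refine (sum_le_sum fun f _ => h3 f).trans ?_
    rw [sum_add_distrib, sum_comm, sum_congr rfl h6]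
    simp only [sum_const, card_univ, nsmul_eq_mul, offDiag_card, Fintype.card_fun, Fintype.card_fin]
    push_cast [Nat.cast_sub (Nat.le_mul_self (r + 1))]
    rw [← hp]
    apply le_of_eq
    ring
  set K : ℝ := (M : ℝ) ^ (r + 1) with hK
  have hK0 : 0 < K := by rw [hK]; positivity
  have hKp : K * (r + 1) ^ 2 ≤ p := by rw [hp, hK]; exact_mod_cast hP
  have hKq : K * (r + 1) ^ 2 ≤ q := by rw [hq, hK]; exact_mod_cast hS
  have h8 : (M * e) ^ (r + 1) ≤ (p * q) ^ (r + 1) := by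
    rw [mul_pow, ← hK]
    have h9 : e ^ (r + 1) ≤
        q ^ r * (p ^ (r + 1) * r + ((r + 1) ^ 2 - (r + 1)) * (p ^ (r + 1) * q / p)) :=
      h1.trans (by rw [h2]; gcongr)
    have h10 : K * (r + ((r : ℝ) + 1) ^ 2 - (r + 1)) ≤ K * (r + 1) ^ 2 := by
      gcongr; linarith
    have hr : (0 : ℝ) ≤ r := by positivity
    calc K * e ^ (r + 1) ≤ K * (q ^ r * (p ^ (r + 1) * r +
          ((r + 1) ^ 2 - (r + 1)) * (p ^ (r + 1) * q / p))) := by gcongr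
      _ = q ^ r * p ^ (r + 1) * (K * r + K * ((r + 1) ^ 2 - (r + 1)) / p * q) := by ring
      _ ≤ q ^ r * p ^ (r + 1) * q := by
        gcongr
        have h11 : K * (((r : ℝ) + 1) ^ 2 - (r + 1)) / p ≤ 1 - r / (r + 1) ^ 2 := by
          rw [div_le_iff₀ hp0]
          have h12 : (1 : ℝ) - r / (r + 1) ^ 2 = ((r + 1) ^ 2 - r) / (r + 1) ^ 2 := by
            field_simp
          rw [h12, div_mul_eq_mul_div, le_div_iff₀ (by positivity)]
          have h13 : 0 ≤ ((r : ℝ) + 1) ^ 2 - r := by nlinarith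
          calc K * (((r : ℝ) + 1) ^ 2 - (r + 1)) * (r + 1) ^ 2
              ≤ K * (((r : ℝ) + 1) ^ 2 - r) * (r + 1) ^ 2 := by gcongr; linarith
            _ = (((r : ℝ) + 1) ^ 2 - r) * (K * (r + 1) ^ 2) := by ring
            _ ≤ _ := by gcongr
        have h14 : K * r ≤ r / (r + 1) ^ 2 * q := by
          rw [div_mul_eq_mul_div, le_div_iff₀ (by positivity)]
          nlinarith
        nlinarith
      _ = (p * q) ^ (r + 1) := by ring
  exact le_of_pow_le_pow_left₀ (by omega) (by positivity) h8

open Finset in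
/-- A dense relation with few conflicts contains a complete pattern without conflicts. -/
lemma exists_conflict_free_pattern {A B : Type*} [Fintype A] [Fintype B] [Nonempty A] [Nonempty B]
    (E : A → B → Prop) (Conf : A → A → B → B → Prop) {s q M : ℕ}
    (hs : 1 ≤ s)
    (hE : ∀ x, (Fintype.card B : ℝ) ≤ q * ∑ y, propInd (E x y))
    (hConf : (M : ℝ) * ∑ x, ∑ x', ∑ y, ∑ y', propInd (Conf x x' y y') ≤
      6 * (Fintype.card A : ℝ) ^ 2 * (Fintype.card B : ℝ) ^ 2)
    (hM : 6 * s ^ 4 * q ^ (s * s) < M) :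
    ∃ (ζ : Fin s → A) (β : Fin s → B), (∀ i j, E (ζ i) (β j)) ∧
      ∀ i i' j j', i ≠ i' → j ≠ j' → ¬ Conf (ζ i) (ζ i') (β j) (β j') := by
  classical
  by_contra hno
  push Not at hno
  set m : ℝ := (Fintype.card A : ℝ) with hm
  set n : ℝ := (Fintype.card B : ℝ) with hn
  have hm0 : 0 < m := by rw [hm]; exact_mod_cast Fintype.card_pos
  have hn0 : 0 < n := by rw [hn]; exact_mod_cast Fintype.card_pos
  let Ef : A → B → ℝ := fun x y => propInd (E x y)
  have hEf : ∀ x y, 0 ≤ Ef x y := fun x y => propInd_nonneg _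
  let Cf : A → A → B → B → ℝ := fun x x' y y' => propInd (Conf x x' y y')
  have hCf : ∀ x x' y y', 0 ≤ Cf x x' y y' := fun x x' y y' => propInd_nonneg _
  set e : ℝ := ∑ y, ∑ x, Ef x y with he
  have hE' : m * n ≤ q * e := by
    calc m * n = ∑ x : A, n := by simp [hm]
      _ ≤ ∑ x, q * ∑ y, Ef x y := sum_le_sum fun x _ => hE x
      _ = q * e := by rw [← mul_sum, he, sum_comm]
  have he0 : 0 ≤ e := sum_nonneg fun y _ => sum_nonneg fun x _ => hEf x y
  set N : ℝ := ∑ ζ : Fin s → A, ∑ β : Fin s → B, ∏ j, ∏ i, Ef (ζ i) (β j) with hN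
  obtain ⟨r, rfl⟩ : ∃ r, s = r + 1 := ⟨s - 1, by omega⟩
  have hN1 : N = ∑ ζ : Fin (r + 1) → A, (∑ y, ∏ i, Ef (ζ i) y) ^ (r + 1) := by
    simp_rw [Fintype.sum_pow]; rfl
  have hmid : ∑ ζ : Fin (r + 1) → A, ∑ y, ∏ i, Ef (ζ i) y = ∑ y, (∑ x, Ef x y) ^ (r + 1) := by
    simp_rw [Fintype.sum_pow]; rw [sum_comm]
  have hA : e ^ (r + 1) ≤ n ^ r * ∑ y, (∑ x, Ef x y) ^ (r + 1) :=
    pow_sum_le_card_pow_mul_sum_pow _ (fun y => sum_nonneg fun x _ => hEf x y) r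
  have hB : (∑ y, (∑ x, Ef x y) ^ (r + 1)) ^ (r + 1) ≤ (m ^ (r + 1)) ^ r * N := by
    rw [← hmid, hN1]
    have := pow_sum_le_card_pow_mul_sum_pow (fun ζ : Fin (r + 1) → A => ∑ y, ∏ i, Ef (ζ i) y)
      (fun ζ => sum_nonneg fun y _ => prod_nonneg fun i _ => hEf _ _) r
    simpa [hm] using this
  have hlow : m ^ (r + 1) * n ^ (r + 1) ≤ q ^ ((r + 1) * (r + 1)) * N := by
    have h1 : (m * n) ^ ((r + 1) * (r + 1)) ≤
        q ^ ((r + 1) * (r + 1)) * (n ^ (r * (r + 1)) * ((m ^ (r + 1)) ^ r * N)) := by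
      calc (m * n) ^ ((r + 1) * (r + 1)) ≤ (q * e) ^ ((r + 1) * (r + 1)) := by gcongr
        _ = q ^ ((r + 1) * (r + 1)) * (e ^ (r + 1)) ^ (r + 1) := by rw [mul_pow, ← pow_mul e]
        _ ≤ q ^ ((r + 1) * (r + 1)) * (n ^ r * ∑ y, (∑ x, Ef x y) ^ (r + 1)) ^ (r + 1) := by gcongr
        _ = q ^ ((r + 1) * (r + 1)) *
            (n ^ (r * (r + 1)) * (∑ y, (∑ x, Ef x y) ^ (r + 1)) ^ (r + 1)) := by
          rw [mul_pow (n ^ r), ← pow_mul]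
        _ ≤ _ := by gcongr
    have h2 : (m * n) ^ ((r + 1) * (r + 1)) =
        (n ^ (r * (r + 1)) * (m ^ (r + 1)) ^ r) * (m ^ (r + 1) * n ^ (r + 1)) := by ring
    rw [h2] at h1
    refine le_of_mul_le_mul_left (a := n ^ (r * (r + 1)) * (m ^ (r + 1)) ^ r) ?_ (by positivity)
    calc _ ≤ _ := h1
      _ = _ := by ring
  have hub : N ≤ ∑ ii ∈ (univ : Finset (Fin (r + 1))).offDiag,
      ∑ jj ∈ (univ : Finset (Fin (r + 1))).offDiag,
      ∑ ζ : Fin (r + 1) → A, ∑ β : Fin (r + 1) → B, Cf (ζ ii.1) (ζ ii.2) (β jj.1) (β jj.2) := by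
    have hpt : ∀ (ζ : Fin (r + 1) → A) (β : Fin (r + 1) → B), ∏ j, ∏ i, Ef (ζ i) (β j) ≤
        ∑ ii ∈ (univ : Finset (Fin (r + 1))).offDiag, ∑ jj ∈ (univ : Finset (Fin (r + 1))).offDiag,
          Cf (ζ ii.1) (ζ ii.2) (β jj.1) (β jj.2) := by
      intro ζ β
      have hnn : 0 ≤ ∑ ii ∈ (univ : Finset (Fin (r + 1))).offDiag,
          ∑ jj ∈ (univ : Finset (Fin (r + 1))).offDiag,
          Cf (ζ ii.1) (ζ ii.2) (β jj.1) (β jj.2) :=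
        sum_nonneg fun _ _ => sum_nonneg fun _ _ => hCf _ _ _ _
      by_cases hall : ∀ i j, E (ζ i) (β j)
      · obtain ⟨i, i', j, j', hi, hj, hc⟩ := hno ζ β hall
        have h1 : ∏ j, ∏ i, Ef (ζ i) (β j) = 1 :=
          prod_eq_one fun j _ => prod_eq_one fun i _ => propInd_of (hall i j)
        rw [h1]
        calc (1 : ℝ) = Cf (ζ i) (ζ i') (β j) (β j') := (propInd_of hc).symm
          _ ≤ ∑ jj ∈ (univ : Finset (Fin (r + 1))).offDiag,
              Cf (ζ i) (ζ i') (β jj.1) (β jj.2) :=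
            single_le_sum (f := fun jj : Fin (r + 1) × Fin (r + 1) =>
              Cf (ζ i) (ζ i') (β jj.1) (β jj.2)) (fun _ _ => hCf _ _ _ _) (a := (j, j'))
              (by simpa using hj)
          _ ≤ _ := single_le_sum (f := fun ii : Fin (r + 1) × Fin (r + 1) =>
              ∑ jj ∈ (univ : Finset (Fin (r + 1))).offDiag,
              Cf (ζ ii.1) (ζ ii.2) (β jj.1) (β jj.2))
              (fun _ _ => sum_nonneg fun _ _ => hCf _ _ _ _) (a := (i, i')) (by simpa using hi)
      · push Not at hall
        obtain ⟨i, j, hij⟩ := hall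
        have h1 : ∏ j, ∏ i, Ef (ζ i) (β j) = 0 :=
          prod_eq_zero (mem_univ j) (prod_eq_zero (mem_univ i) (propInd_of_not hij))
        rw [h1]; exact hnn
    calc N ≤ ∑ ζ : Fin (r + 1) → A, ∑ β : Fin (r + 1) → B,
          ∑ ii ∈ (univ : Finset (Fin (r + 1))).offDiag,
          ∑ jj ∈ (univ : Finset (Fin (r + 1))).offDiag,
          Cf (ζ ii.1) (ζ ii.2) (β jj.1) (β jj.2) :=
        sum_le_sum fun ζ _ => sum_le_sum fun β _ => hpt ζ β
      _ = _ := by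
        simp_rw [sum_comm (s := (univ : Finset (Fin (r + 1) → B)))]
        simp_rw [sum_comm (s := (univ : Finset (Fin (r + 1) → A)))]
  set c : ℝ := ∑ x, ∑ x', ∑ y, ∑ y', Cf x x' y y' with hc
  have hterm : ∀ ii ∈ (univ : Finset (Fin (r + 1))).offDiag,
      ∀ jj ∈ (univ : Finset (Fin (r + 1))).offDiag,
      (∑ ζ : Fin (r + 1) → A, ∑ β : Fin (r + 1) → B, Cf (ζ ii.1) (ζ ii.2) (β jj.1) (β jj.2))
        * (m ^ 2 * n ^ 2) = m ^ (r + 1) * n ^ (r + 1) * c := by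
    intro ii hii jj hjj
    have h1 : ∀ x x', (∑ β : Fin (r + 1) → B, Cf x x' (β jj.1) (β jj.2)) * n ^ 2 =
        n ^ (r + 1) * ∑ y, ∑ y', Cf x x' y y' := fun x x' =>
      sum_pair_coordinates (by simpa using hjj : jj.1 ≠ jj.2) (Cf x x')
    have h2 := sum_pair_coordinates (by simpa using hii : ii.1 ≠ ii.2)
      (fun x x' => (∑ β : Fin (r + 1) → B, Cf x x' (β jj.1) (β jj.2)) * n ^ 2)
    simp only [h1] at h2
    simp only [← mul_sum] at h2
    rw [← hm, ← hc] at h2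
    calc _ = ∑ ζ : Fin (r + 1) → A, ((∑ β : Fin (r + 1) → B,
            Cf (ζ ii.1) (ζ ii.2) (β jj.1) (β jj.2)) * n ^ 2) * m ^ 2 := by
          rw [sum_mul]; exact sum_congr rfl fun _ _ => by ring
      _ = (∑ ζ : Fin (r + 1) → A, n ^ (r + 1) * ∑ y, ∑ y', Cf (ζ ii.1) (ζ ii.2) y y') * m ^ 2 := by
          rw [sum_mul]; exact sum_congr rfl fun _ _ => by rw [h1]
      _ = m ^ (r + 1) * n ^ (r + 1) * c := by rw [← mul_sum, h2]; ring
  have hc0 : 0 ≤ c := sum_nonneg fun _ _ => sum_nonneg fun _ _ => sum_nonneg fun _ _ =>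
    sum_nonneg fun _ _ => hCf _ _ _ _
  have hNc : N * (m ^ 2 * n ^ 2) ≤ (r + 1) ^ 4 * (m ^ (r + 1) * n ^ (r + 1) * c) := by
    calc N * (m ^ 2 * n ^ 2) ≤ _ := mul_le_mul_of_nonneg_right hub (by positivity)
      _ = ∑ ii ∈ (univ : Finset (Fin (r + 1))).offDiag,
          ∑ jj ∈ (univ : Finset (Fin (r + 1))).offDiag, m ^ (r + 1) * n ^ (r + 1) * c := by
        rw [sum_mul]
        refine sum_congr rfl fun ii hii => ?_
        rw [sum_mul]
        exact sum_congr rfl fun jj hjj => hterm ii hii jj hjj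
      _ = (((r + 1) * (r + 1) - (r + 1) : ℕ) : ℝ) ^ 2 * (m ^ (r + 1) * n ^ (r + 1) * c) := by
        simp only [sum_const, nsmul_eq_mul, offDiag_card, card_univ, Fintype.card_fin]
        ring
      _ ≤ (((r + 1) * (r + 1) : ℕ) : ℝ) ^ 2 * (m ^ (r + 1) * n ^ (r + 1) * c) := by
        gcongr
        exact Nat.sub_le _ _
      _ = _ := by push_cast; ring
  have hM' : (6 : ℝ) * (r + 1) ^ 4 * q ^ ((r + 1) * (r + 1)) < M := by exact_mod_cast hM
  have hConf' : (M : ℝ) * c ≤ 6 * m ^ 2 * n ^ 2 := hConf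
  have hW : 0 < m ^ (r + 1) * n ^ (r + 1) * (m ^ 2 * n ^ 2) := by positivity
  have hfin : M * (m ^ (r + 1) * n ^ (r + 1) * (m ^ 2 * n ^ 2)) ≤
      (6 * (r + 1) ^ 4 * q ^ ((r + 1) * (r + 1))) *
        (m ^ (r + 1) * n ^ (r + 1) * (m ^ 2 * n ^ 2)) := by
    calc M * (m ^ (r + 1) * n ^ (r + 1) * (m ^ 2 * n ^ 2))
        = M * (m ^ (r + 1) * n ^ (r + 1)) * (m ^ 2 * n ^ 2) := by ring
      _ ≤ M * (q ^ ((r + 1) * (r + 1)) * N) * (m ^ 2 * n ^ 2) := by gcongr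
      _ = M * q ^ ((r + 1) * (r + 1)) * (N * (m ^ 2 * n ^ 2)) := by ring
      _ ≤ M * q ^ ((r + 1) * (r + 1)) * ((r + 1) ^ 4 * (m ^ (r + 1) * n ^ (r + 1) * c)) := by gcongr
      _ = q ^ ((r + 1) * (r + 1)) * (r + 1) ^ 4 * (m ^ (r + 1) * n ^ (r + 1)) * (M * c) := by ring
      _ ≤ q ^ ((r + 1) * (r + 1)) * (r + 1) ^ 4 * (m ^ (r + 1) * n ^ (r + 1)) *
          (6 * m ^ 2 * n ^ 2) := by gcongr
      _ = _ := by ring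
  have := lt_of_le_of_lt hfin (mul_lt_mul_of_pos_right hM' hW)
  exact lt_irrefl _ this

/-- `x` lies in the closed neighbourhood of `y`. -/
def ClosedAdj {V : Type*} (G : SimpleGraph V) (x y : V) : Prop := x = y ∨ G.Adj x y

lemma ClosedAdj.symm {V : Type*} {G : SimpleGraph V} {x y : V} (h : ClosedAdj G x y) :
    ClosedAdj G y x :=
  h.imp Eq.symm fun h => h.symm

lemma mem_ballAround_one {V : Type*} {G : SimpleGraph V} {S : Set V} {v : V} :
    v ∈ ballAround G S 1 ↔ ∃ u ∈ S, ClosedAdj G u v := by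
  simp only [ballAround, Set.mem_ofPred_eq, Nat.cast_one, SimpleGraph.edist_le_one_iff_adj_or_eq,
    ClosedAdj]
  exact exists_congr fun u => and_congr_right fun _ => or_comm

/-- A combinatorial form of the balanced separators of `G[A]` for the indicator weight of a set. -/
lemma AdmitsBalancedSeparators.exists_centres {V : Type*} [Finite V] {G : SimpleGraph V}
    {A : Set V} {k : ℕ} (h : AdmitsBalancedSeparators (G.induce A) k 1) {I : Set V} (hI : I ⊆ A) :
    ∃ T ⊆ A, T.ncard ≤ k ∧ ∀ D ⊆ A, (∀ z ∈ T, ∀ v ∈ D, ¬ ClosedAdj G z v) →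
      (G.induce D).Preconnected → 2 * (I ∩ D).ncard ≤ I.ncard := by
  classical
  have := Fintype.ofFinite V
  obtain ⟨S, ⟨T, hTk, hST⟩, hbal⟩ := h fun v => if (v : V) ∈ I then 1 else 0
  refine ⟨Subtype.val '' T, by simp, ?_, fun D hDA hDT hD => ?_⟩
  · rwa [Set.ncard_image_of_injective _ Subtype.val_injective]
  rcases D.eq_empty_or_nonempty with rfl | ⟨d, hd⟩
  · simp
  have hDS : ∀ v (hv : v ∈ D), (⟨v, hDA hv⟩ : A) ∈ Sᶜ := by
    intro v hv hvS
    obtain ⟨z, hz, hzv⟩ := mem_ballAround_one.1 (hST hvS)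
    refine hDT z ⟨z, hz, rfl⟩ v hv ?_
    rcases hzv with hzv | hzv
    · exact Or.inl (congrArg Subtype.val hzv)
    · exact Or.inr hzv
  let f : G.induce D →g (G.induce A).induce Sᶜ :=
    ⟨fun v => ⟨⟨v, hDA v.2⟩, hDS v v.2⟩, fun {a b} hab => hab⟩
  let C := ((G.induce A).induce Sᶜ).connectedComponentMk (f ⟨d, hd⟩)
  have hC := hbal C
  have htot : (∑ᶠ v : A, (if (v : V) ∈ I then (1 : NNReal) else 0)) = I.ncard := by
    rw [finsum_eq_sum_of_fintype, ← Finset.sum_filter, Finset.sum_const, nsmul_eq_mul, mul_one,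
      ← Set.ncard_coe_finset, ← Set.ncard_image_of_injective _ Subtype.val_injective]
    congr 2
    ext v
    simp only [Finset.coe_filter, Finset.mem_univ, true_and, Set.mem_image, Set.mem_ofPred_eq,
      Subtype.exists, exists_and_left, exists_prop, exists_eq_right_right]
    exact ⟨fun h => h.1, fun h => ⟨h, hI h⟩⟩
  have hle : ((I ∩ D).ncard : NNReal) ≤
      ∑ᶠ v ∈ C.supp, (if ((v : A) : V) ∈ I then (1 : NNReal) else 0) := by
    rw [finsum_mem_eq_finite_toFinset_sum _ (Set.toFinite _), ← Finset.sum_filter, Finset.sum_const,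
      nsmul_eq_mul, mul_one, Nat.cast_le, ← Set.ncard_coe_finset,
      ← Set.ncard_image_of_injective _ Subtype.val_injective,
      ← Set.ncard_image_of_injective _ Subtype.val_injective]
    refine Set.ncard_le_ncard ?_ (Set.toFinite _)
    rintro v ⟨hvI, hvD⟩
    refine ⟨⟨v, hDA hvD⟩, ⟨f ⟨v, hvD⟩, ?_, rfl⟩, rfl⟩
    simp only [Finset.coe_filter, Set.Finite.mem_toFinset, Set.mem_ofPred_eq]
    refine ⟨?_, hvI⟩
    rw [SimpleGraph.ConnectedComponent.mem_supp_iff]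
    exact SimpleGraph.ConnectedComponent.sound ((hD ⟨v, hvD⟩ ⟨d, hd⟩).map f)
  rw [htot] at hC
  have h2 := hle.trans hC
  rw [le_div_iff₀ (by norm_num)] at h2
  have : (I ∩ D).ncard * 2 ≤ I.ncard := by exact_mod_cast h2
  omega

lemma preconnected_induce_of_reachable {V : Type*} {G : SimpleGraph V} {D : Set V} (b : D)
    (h : ∀ v : D, (G.induce D).Reachable v b) : (G.induce D).Preconnected :=
  fun u v => (h u).trans (h v).symm

/-- A grid `a i j` whose rows are attached to `ζ i` and whose columns are attached to `β j`, with
no adjacency between elements in different rows and different columns, has no small dominated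
balanced separator. -/
lemma not_admitsBalancedSeparators_of_pattern {V : Type*} [Finite V] {G : SimpleGraph V} {k : ℕ}
    (ζ β : Fin (2 * k + 2) → V) (a : Fin (2 * k + 2) → Fin (2 * k + 2) → V)
    (hζa : ∀ i j, G.Adj (ζ i) (a i j)) (hβa : ∀ i j, G.Adj (β j) (a i j))
    (hζζ : ∀ i i', i ≠ i' → ¬ ClosedAdj G (ζ i) (ζ i'))
    (hββ : ∀ j j', j ≠ j' → ¬ ClosedAdj G (β j) (β j'))
    (hζβ : ∀ i j, ¬ ClosedAdj G (ζ i) (β j))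
    (hζa' : ∀ i i' j, i ≠ i' → ¬ ClosedAdj G (ζ i') (a i j))
    (hβa' : ∀ i j j', j ≠ j' → ¬ ClosedAdj G (β j') (a i j))
    (haa : ∀ i i' j j', i ≠ i' → j ≠ j' → ¬ ClosedAdj G (a i j) (a i' j')) :
    ∃ A : Set V, ¬ AdmitsBalancedSeparators (G.induce A) k 1 := by
  classical
  refine ⟨Set.range ζ ∪ Set.range β ∪ {v | ∃ i j, a i j = v}, fun hadm => ?_⟩
  set A := Set.range ζ ∪ Set.range β ∪ {v | ∃ i j, a i j = v} with hA
  have hζA : ∀ i, ζ i ∈ A := fun i => Or.inl (Or.inl ⟨i, rfl⟩)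
  have hβA : ∀ j, β j ∈ A := fun j => Or.inl (Or.inr ⟨j, rfl⟩)
  have haA : ∀ i j, a i j ∈ A := fun i j => Or.inr ⟨i, j, rfl⟩
  obtain ⟨T, hTA, hTk, hT⟩ := hadm.exists_centres (I := Set.range ζ)
    (by rintro _ ⟨i, rfl⟩; exact hζA i)
  have htouch : ∀ w, ∃ rc : Fin (2 * k + 2) × Fin (2 * k + 2), w ∈ A → ∀ i j, i ≠ rc.1 → j ≠ rc.2 →
      ¬ ClosedAdj G w (ζ i) ∧ ¬ ClosedAdj G w (β j) ∧ ¬ ClosedAdj G w (a i j) := by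
    intro w
    by_cases hw : w ∈ A
    · rcases hw with (⟨i₀, rfl⟩ | ⟨j₀, rfl⟩) | ⟨i₀, j₀, rfl⟩
      · exact ⟨(i₀, i₀), fun _ i j hi _ => ⟨hζζ _ _ hi.symm, hζβ _ _, hζa' _ _ _ hi⟩⟩
      · exact ⟨(j₀, j₀), fun _ i j _ hj => ⟨fun h => hζβ _ _ h.symm, hββ _ _ hj.symm,
          hβa' _ _ _ hj⟩⟩
      · exact ⟨(i₀, j₀), fun _ i j hi hj => ⟨fun h => hζa' _ _ _ hi.symm h.symm,
          fun h => hβa' _ _ _ hj.symm h.symm, haa _ _ _ _ hi.symm hj.symm⟩⟩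
    · exact ⟨(0, 0), fun h => absurd h hw⟩
  choose rc hrc using htouch
  set R : Set (Fin (2 * k + 2)) := (fun w => (rc w).1) '' T with hR
  set Co : Set (Fin (2 * k + 2)) := (fun w => (rc w).2) '' T with hCo
  have hRk : R.ncard ≤ k := (Set.ncard_image_le (Set.toFinite _)).trans hTk
  have hCk : Co.ncard ≤ k := (Set.ncard_image_le (Set.toFinite _)).trans hTk
  have hcompl : ∀ Q : Set (Fin (2 * k + 2)), Q.ncard ≤ k → k + 2 ≤ Qᶜ.ncard := by
    intro Q hQ
    have := Set.ncard_add_ncard_compl Q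
    rw [Nat.card_eq_fintype_card, Fintype.card_fin] at this
    omega
  have hRc := hcompl R hRk
  obtain ⟨j, hj⟩ : Coᶜ.Nonempty := Set.nonempty_of_ncard_ne_zero (by have := hcompl Co hCk; omega)
  set D : Set V := {v | v = β j ∨ ∃ i ∉ R, v = ζ i ∨ v = a i j} with hD
  have hbD : β j ∈ D := Or.inl rfl
  have hζD : ∀ i ∉ R, ζ i ∈ D := fun i hi => Or.inr ⟨i, hi, Or.inl rfl⟩
  have haD : ∀ i ∉ R, a i j ∈ D := fun i hi => Or.inr ⟨i, hi, Or.inr rfl⟩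
  obtain ⟨i₁, hi₁⟩ : Rᶜ.Nonempty := Set.nonempty_of_ncard_ne_zero (by omega)
  have hone := hT D
    (by
      rintro v (rfl | ⟨i, _, rfl | rfl⟩)
      exacts [hβA _, hζA _, haA _ _])
    (by
      have hav : ∀ z ∈ T, ∀ i ∉ R, ¬ ClosedAdj G z (ζ i) ∧ ¬ ClosedAdj G z (β j) ∧
          ¬ ClosedAdj G z (a i j) := fun z hz i hi =>
        hrc z (hTA hz) i j (fun h => hi ⟨z, hz, h.symm⟩) (fun h => hj ⟨z, hz, h.symm⟩)
      rintro z hz v (rfl | ⟨i, hi, rfl | rfl⟩)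
      · exact (hav z hz i₁ hi₁).2.1
      · exact (hav z hz i hi).1
      · exact (hav z hz i hi).2.2)
    (by
      have hra : ∀ i (hi : i ∉ R), (G.induce D).Reachable ⟨a i j, haD i hi⟩ ⟨β j, hbD⟩ :=
        fun i hi => SimpleGraph.Adj.reachable (by simpa using (hβa i j).symm)
      refine preconnected_induce_of_reachable ⟨β j, hbD⟩ ?_
      rintro ⟨v, rfl | ⟨i, hi, rfl | rfl⟩⟩
      · exact SimpleGraph.Reachable.refl _
      · exact SimpleGraph.Reachable.trans
          (SimpleGraph.Adj.reachable (by simpa using hζa i j)) (hra i hi)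
      · exact hra i hi)
  have hinj : Function.Injective ζ := fun i i' h => by
    by_contra hne
    exact hζζ i i' hne (Or.inl h)
  have h1 : (Set.range ζ).ncard = 2 * k + 2 := by
    rw [← Set.image_univ, Set.ncard_image_of_injective _ hinj, Set.ncard_univ]
    simp
  have h2 : Rᶜ.ncard ≤ (Set.range ζ ∩ D).ncard := by
    rw [← Set.ncard_image_of_injective _ hinj]
    refine Set.ncard_le_ncard ?_ (Set.toFinite _)
    rintro _ ⟨i, hi, rfl⟩
    exact ⟨⟨i, rfl⟩, hζD i hi⟩
  omega

section IndepNum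

variable {V : Type*} [Finite V] {G : SimpleGraph V}

lemma bddAbove_indepNumOn (G : SimpleGraph V) (Y : Set V) :
    BddAbove {n : ℕ | ∃ s ⊆ Y, s.ncard = n ∧ s.Pairwise fun u v => ¬ G.Adj u v} := by
  refine ⟨Nat.card V, ?_⟩
  rintro n ⟨s, -, rfl, -⟩
  rw [← Set.ncard_univ]
  exact Set.ncard_le_ncard (Set.subset_univ s) (Set.toFinite _)

lemma ncard_le_indepNumOn {Y s : Set V} (hs : s ⊆ Y) (hi : G.IsIndepSet s) :
    s.ncard ≤ indepNumOn G Y :=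
  le_csSup (bddAbove_indepNumOn G Y) ⟨s, hs, rfl, hi⟩

lemma exists_ncard_eq_indepNumOn (G : SimpleGraph V) (Y : Set V) :
    ∃ s ⊆ Y, G.IsIndepSet s ∧ s.ncard = indepNumOn G Y := by
  obtain ⟨s, h1, h2, h3⟩ := Nat.sSup_mem (s := {n : ℕ | ∃ s ⊆ Y, s.ncard = n ∧
    s.Pairwise fun u v => ¬ G.Adj u v}) ⟨0, ∅, by simp, by simp, by simp⟩ (bddAbove_indepNumOn G Y)
  exact ⟨s, h1, h3, h2⟩

lemma indepNumOn_mono {Y Y' : Set V} (h : Y ⊆ Y') : indepNumOn G Y ≤ indepNumOn G Y' := by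
  obtain ⟨s, hs, hi, hc⟩ := exists_ncard_eq_indepNumOn G Y
  exact hc ▸ ncard_le_indepNumOn (hs.trans h) hi

lemma indepNumOn_union_le (Y Y' : Set V) :
    indepNumOn G (Y ∪ Y') ≤ indepNumOn G Y + indepNumOn G Y' := by
  obtain ⟨s, hs, hi, hc⟩ := exists_ncard_eq_indepNumOn G (Y ∪ Y')
  have h1 := ncard_le_indepNumOn (G := G) (Y := Y) (s := s ∩ Y) Set.inter_subset_right
    (hi.mono Set.inter_subset_left)
  have h2 := ncard_le_indepNumOn (G := G) (Y := Y') (s := s ∩ Y') Set.inter_subset_right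
    (hi.mono Set.inter_subset_left)
  have h3 := Set.ncard_union_le (s ∩ Y) (s ∩ Y')
  rw [← Set.inter_union_distrib_left, Set.inter_eq_left.2 hs] at h3
  omega

lemma indepNumOn_le_ncard (Y : Set V) : indepNumOn G Y ≤ Y.ncard := by
  obtain ⟨s, hs, -, hc⟩ := exists_ncard_eq_indepNumOn G Y
  exact hc ▸ Set.ncard_le_ncard hs (Set.toFinite _)

/-- An independent set of maximum size in `Y` dominates `Y`. -/
lemma exists_closedAdj_of_ncard_eq {Y I : Set V} (hI : I ⊆ Y) (hi : G.IsIndepSet I)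
    (hc : I.ncard = indepNumOn G Y) {y : V} (hy : y ∈ Y) : ∃ i ∈ I, ClosedAdj G i y := by
  by_contra hno
  push Not at hno
  have hyI : y ∉ I := fun h => hno y h (Or.inl rfl)
  have h1 := ncard_le_indepNumOn (G := G) (Y := Y) (s := insert y I)
    (Set.insert_subset hy hI) (by
      refine Set.pairwise_insert.2 ⟨hi, fun b hb _ => ⟨?_, ?_⟩⟩
      · exact fun h => hno b hb (Or.inr h.symm)
      · exact fun h => hno b hb (Or.inr h))
  rw [Set.ncard_insert_of_notMem hyI] at h1
  omega

/-- An independent subset of `Y` can be matched into any independent set of maximum size. -/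
lemma exists_matching_of_ncard_eq {Y I S : Set V} (hI : I ⊆ Y) (hi : G.IsIndepSet I)
    (hc : I.ncard = indepNumOn G Y) (hS : S ⊆ Y) (hSi : G.IsIndepSet S) :
    ∃ f : S → I, Function.Injective f ∧ ∀ x : S, ClosedAdj G (x : V) (f x) := by
  classical
  have := Fintype.ofFinite V
  have hall := (Finset.all_card_le_biUnion_card_iff_exists_injective
    (fun x : S => Finset.univ.filter fun b : I => ClosedAdj G (x : V) b)).1 ?_
  · obtain ⟨f, hf, hf'⟩ := hall
    exact ⟨f, hf, fun x => by simpa using hf' x⟩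
  intro W
  set N := W.biUnion fun x : S => Finset.univ.filter fun b : I => ClosedAdj G (x : V) b with hN
  have hNmem : ∀ b : I, b ∈ N ↔ ∃ x ∈ W, ClosedAdj G (x : V) b := by
    intro b; simp [hN]
  set W' : Set V := Subtype.val '' (W : Set S) with hW'
  set N' : Set V := Subtype.val '' (N : Set I) with hN'
  have hWc : W'.ncard = W.card := by
    rw [hW', Set.ncard_image_of_injective _ Subtype.val_injective, Set.ncard_coe_finset]
  have hNc : N'.ncard = N.card := by
    rw [hN', Set.ncard_image_of_injective _ Subtype.val_injective, Set.ncard_coe_finset]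
  have hN'I : N' ⊆ I := by rintro _ ⟨b, -, rfl⟩; exact b.2
  have hcross : ∀ w ∈ W', ∀ b ∈ I \ N', ¬ ClosedAdj G w b := by
    rintro _ ⟨x, hx, rfl⟩ b ⟨hb, hb'⟩ h
    exact hb' ⟨⟨b, hb⟩, (hNmem _).2 ⟨x, hx, h⟩, rfl⟩
  have hW'S : W' ⊆ S := by rintro _ ⟨x, -, rfl⟩; exact x.2
  have hdisj : Disjoint W' (I \ N') :=
    Set.disjoint_left.2 fun w hw hw' => hcross w hw w hw' (Or.inl rfl)
  have h1 := ncard_le_indepNumOn (G := G) (Y := Y) (s := W' ∪ I \ N')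
    (Set.union_subset (hW'S.trans hS) (Set.sdiff_subset.trans hI)) (by
      refine Set.pairwise_union.2 ⟨hSi.mono hW'S, hi.mono Set.sdiff_subset,
        fun a ha b hb _ => ⟨?_, ?_⟩⟩
      · exact fun h => hcross a ha b hb (Or.inr h)
      · exact fun h => hcross a ha b hb (Or.inr h.symm))
  rw [Set.ncard_union_eq hdisj (Set.toFinite _) (Set.toFinite _), ← hc,
    ← Set.ncard_sdiff_add_ncard_of_subset hN'I (Set.toFinite _)] at h1
  omega

end IndepNum

/-- Two independent families that are completely joined form an induced complete bipartite
graph. -/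
lemma not_isEmpty_embedding_of_adj {V : Type*} {G : SimpleGraph V} {t : ℕ} {x y : Fin t → V}
    (hx : Function.Injective x) (hy : Function.Injective y)
    (hxx : ∀ i j, ¬ G.Adj (x i) (x j)) (hyy : ∀ i j, ¬ G.Adj (y i) (y j))
    (hxy : ∀ i j, G.Adj (x i) (y j)) :
    ¬ IsEmpty (completeBipartiteGraph (Fin t) (Fin t) ↪g G) := by
  rw [not_isEmpty_iff]
  refine ⟨⟨⟨Sum.elim x y, hx.sumElim hy fun i j => (hxy i j).ne⟩, ?_⟩⟩
  rintro (a | a) (b | b)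
  · simp [hxx]
  · simp [hxy]
  · simp [(hxy _ _).symm]
  · simp [hyy]

lemma false_of_closedAdj_biclique {V : Type*} {G : SimpleGraph V} {t : ℕ} (ht : 2 ≤ t)
    (hK : IsEmpty (completeBipartiteGraph (Fin t) (Fin t) ↪g G)) {A B : Set V}
    (hA : G.IsIndepSet A) (hB : G.IsIndepSet B) {x y : Fin t → V}
    (hx : Function.Injective x) (hy : Function.Injective y)
    (hxA : ∀ i, x i ∈ A) (hyB : ∀ i, y i ∈ B) (hxy : ∀ i j, ClosedAdj G (x i) (y j)) : False := by
  have hind : ∀ {C : Set V}, G.IsIndepSet C → ∀ a ∈ C, ∀ b ∈ C, ¬ G.Adj a b := by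
    intro C hC a ha b hb hab
    exact hC ha hb hab.ne hab
  have hne : ∀ i j, x i ≠ y j := by
    intro i j hij
    obtain ⟨j', hj'⟩ : ∃ j' : Fin t, j' ≠ j :=
      have : Nontrivial (Fin t) := Fin.nontrivial_iff_two_le.2 ht
      exists_ne j
    rcases hxy i j' with h | h
    · exact hj' (hy (h.symm.trans hij))
    · rw [hij] at h
      exact hind hB _ (hyB j) _ (hyB j') h
  exact not_isEmpty_embedding_of_adj hx hy (fun i j => hind hA _ (hxA i) _ (hxA j))
    (fun i j => hind hB _ (hyB i) _ (hyB j)) (fun i j => (hxy i j).resolve_left (hne i j)) hK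

lemma sum_propInd_eq {ι : Type*} [Fintype ι] (x : ι) : ∑ y, propInd (x = y) = 1 := by
  classical
  rw [Finset.sum_eq_single x (fun y _ h => propInd_of_not h.symm) (by simp), propInd_of rfl]

open Finset in
/-- The vertices seeing a large independent subset of `X` contain no large independent set. -/
lemma indepNumOn_high_degree_lt {V : Type*} [Finite V] {G : SimpleGraph V} {k t d M : ℕ}
    (ht : 2 ≤ t) (hk : 1 ≤ k)
    (hM : 6 * (2 * k + 2) ^ 4 * (20 * k) ^ ((2 * k + 2) * (2 * k + 2)) < M)
    (hd : M ^ t * t ^ 2 ≤ d)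
    (hK : IsEmpty (completeBipartiteGraph (Fin t) (Fin t) ↪g G))
    (hsep : ∀ A : Set V, AdmitsBalancedSeparators (G.induce A) k 1)
    {X L : Set V} (hX : indepNumOn G X = 10 * d * k)
    (hL : ∀ z ∈ L, d ≤ 2 * indepNumOn G (G.neighborSet z ∩ X)) : indepNumOn G L < d := by
  classical
  have := Fintype.ofFinite V
  by_contra hcon
  push Not at hcon
  have hM0 : 0 < M := by omega
  have hMd : M ≤ M ^ t * t ^ 2 := by
    calc M = M ^ 1 * 1 := by ring
      _ ≤ M ^ t * t ^ 2 := Nat.mul_le_mul (Nat.pow_le_pow_right hM0 (by omega))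
        (Nat.one_le_pow _ _ (by omega))
  have hd0 : 0 < d := by omega
  obtain ⟨Z, hZL, hZi, hZc⟩ := exists_ncard_eq_indepNumOn G L
  obtain ⟨I, hIX, hIi, hIc⟩ := exists_ncard_eq_indepNumOn G X
  have hch : ∀ z : Z, ∃ S : Set V, S ⊆ G.neighborSet z ∩ X ∧ G.IsIndepSet S ∧ d ≤ 2 * S.ncard := by
    intro z
    obtain ⟨S, h1, h2, h3⟩ := exists_ncard_eq_indepNumOn G (G.neighborSet z ∩ X)
    exact ⟨S, h1, h2, h3 ▸ hL z (hZL z.2)⟩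
  choose S hSX hSi hSd using hch
  have hmt : ∀ z : Z, ∃ f : S z → I, Function.Injective f ∧
      ∀ x : S z, ClosedAdj G (x : V) (f x) :=
    fun z => exists_matching_of_ncard_eq hIX hIi hIc ((hSX z).trans Set.inter_subset_right) (hSi z)
  choose f hfinj hfadj using hmt
  let E : Z → I → Prop := fun z b => ∃ x : S z, f z x = b
  have hex : ∀ z b, ∃ v : V, E z b → ∃ h : v ∈ S z, f z ⟨v, h⟩ = b := by
    intro z b
    by_cases h : E z b
    · obtain ⟨x, hx⟩ := h
      exact ⟨x.1, fun _ => ⟨x.2, hx⟩⟩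
    · exact ⟨z, fun h' => absurd h' h⟩
  choose a ha using hex
  have haS : ∀ z b, E z b → a z b ∈ S z := fun z b h => (ha z b h).1
  have haz : ∀ z b, E z b → G.Adj z (a z b) := fun z b h => (hSX z (haS z b h)).1
  have hab : ∀ z b, E z b → ClosedAdj G (a z b) b := fun z b h => by
    obtain ⟨h1, h2⟩ := ha z b h
    have := hfadj z ⟨a z b, h1⟩
    rwa [h2] at this
  have hainj : ∀ z b b', E z b → E z b' → a z b = a z b' → b = b' := by
    intro z b b' h h' hbb
    obtain ⟨h1, h2⟩ := ha z b h
    obtain ⟨h3, h4⟩ := ha z b' h'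
    rw [← h2, ← h4]
    congr 2
  have hmcard : Fintype.card Z = indepNumOn G L := by
    rw [← hZc, ← Nat.card_coe_set_eq, Nat.card_eq_fintype_card]
  have hncard : Fintype.card I = 10 * d * k := by
    rw [← hX, ← hIc, ← Nat.card_coe_set_eq, Nat.card_eq_fintype_card]
  have hdm : d ≤ Fintype.card Z := hmcard ▸ hcon
  have hdn : d ≤ Fintype.card I := by
    rw [hncard]
    calc d = d * 1 := (mul_one d).symm
      _ ≤ d * (10 * k) := Nat.mul_le_mul_left _ (by omega)
      _ = 10 * d * k := by ring
  set m : ℝ := (Fintype.card Z : ℝ) with hm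
  set n : ℝ := (Fintype.card I : ℝ) with hn
  have : Nonempty Z := Fintype.card_pos_iff.1 (by omega)
  have : Nonempty I := Fintype.card_pos_iff.1 (by omega)
  have hE : ∀ z, n ≤ ((20 * k : ℕ) : ℝ) * ∑ b, propInd (E z b) := by
    intro z
    have h1 : (S z).ncard ≤ #{b : I | E z b} := by
      rw [← Nat.card_coe_set_eq, Nat.card_eq_fintype_card, ← card_univ,
        ← card_image_of_injective _ (hfinj z)]
      refine card_le_card fun b hb => ?_
      obtain ⟨x, -, hx⟩ := mem_image.1 hb
      exact mem_filter.2 ⟨mem_univ _, x, hx⟩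
    have h2 : ∑ b, propInd (E z b) = (#{b : I | E z b} : ℝ) := by
      rw [card_filter, Nat.cast_sum]
      refine sum_congr rfl fun b _ => ?_
      by_cases h : E z b <;> simp [propInd, h]
    rw [h2, hn, hncard]
    have h3 := hSd z
    have h4 : 10 * d * k ≤ 20 * k * #{b : I | E z b} := by
      calc 10 * d * k = d * (10 * k) := by ring
        _ ≤ (2 * #{b : I | E z b}) * (10 * k) := Nat.mul_le_mul_right _ (by omega)
        _ = _ := by ring
    exact_mod_cast h4
  let Conf : Z → Z → I → I → Prop := fun z z' b b' =>
    z = z' ∨ b = b' ∨ ClosedAdj G (z : V) b ∨ (E z b ∧ ClosedAdj G (z' : V) (a z b)) ∨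
      (E z b ∧ ClosedAdj G (b' : V) (a z b)) ∨
      (z ≠ z' ∧ E z b ∧ E z' b' ∧ ClosedAdj G (a z b) (a z' b'))
  have hind : ∀ {C : Set V}, G.IsIndepSet C → ∀ u ∈ C, ∀ v ∈ C, ¬ G.Adj u v :=
    fun hC u hu v hv huv => hC hu hv huv.ne huv
  have hvinj : ∀ {C : Set V} {x : Fin t → C}, Function.Injective x →
      Function.Injective fun i => (x i : V) := fun hx => Subtype.val_injective.comp hx
  have q1 : (M : ℝ) * ∑ z : Z, ∑ b : I, propInd (ClosedAdj G (z : V) b) ≤ m * n :=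
    card_rel_mul_le_of_no_biclique _ (by omega) hM0 (hd.trans hdm) (hd.trans hdn) (by
      rintro ⟨x, y, hx, hy, hxy⟩
      exact false_of_closedAdj_biclique ht hK hZi hIi (hvinj hx) (hvinj hy) (fun i => (x i).2)
        (fun i => (y i).2) hxy)
  have hpos : 0 < t := by omega
  have hay : ∀ (z : Z) {y : Fin t → I}, Function.Injective y → (∀ j, E z (y j)) →
      Function.Injective fun j => a z (y j) :=
    fun z y hy h i j hij => hy (hainj z _ _ (h i) (h j) hij)
  have q2 : ∀ z : Z, (M : ℝ) * ∑ z' : Z, ∑ b : I,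
      propInd (E z b ∧ ClosedAdj G (z' : V) (a z b)) ≤ m * n := fun z =>
    card_rel_mul_le_of_no_biclique _ (by omega) hM0 (hd.trans hdm) (hd.trans hdn) (by
      rintro ⟨x, y, hx, hy, hxy⟩
      have hEy : ∀ j, E z (y j) := fun j => (hxy ⟨0, hpos⟩ j).1
      exact false_of_closedAdj_biclique ht hK hZi (hSi z) (hvinj hx) (hay z hy hEy)
        (fun i => (x i).2) (fun j => haS z _ (hEy j)) (fun i j => (hxy i j).2))
  have q3 : ∀ z : Z, (M : ℝ) * ∑ b' : I, ∑ b : I,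
      propInd (E z b ∧ ClosedAdj G (b' : V) (a z b)) ≤ n * n := fun z =>
    card_rel_mul_le_of_no_biclique _ (by omega) hM0 (hd.trans hdn) (hd.trans hdn) (by
      rintro ⟨x, y, hx, hy, hxy⟩
      have hEy : ∀ j, E z (y j) := fun j => (hxy ⟨0, hpos⟩ j).1
      exact false_of_closedAdj_biclique ht hK hIi (hSi z) (hvinj hx) (hay z hy hEy)
        (fun i => (x i).2) (fun j => haS z _ (hEy j)) (fun i j => (hxy i j).2))
  have q4 : ∀ z z' : Z, (M : ℝ) * ∑ b : I, ∑ b' : I,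
      propInd (z ≠ z' ∧ E z b ∧ E z' b' ∧ ClosedAdj G (a z b) (a z' b')) ≤ n * n := fun z z' =>
    card_rel_mul_le_of_no_biclique _ (by omega) hM0 (hd.trans hdn) (hd.trans hdn) (by
      rintro ⟨x, y, hx, hy, hxy⟩
      have hEx : ∀ j, E z (x j) := fun j => (hxy j ⟨0, hpos⟩).2.1
      have hEy : ∀ j, E z' (y j) := fun j => (hxy ⟨0, hpos⟩ j).2.2.1
      exact false_of_closedAdj_biclique ht hK (hSi z) (hSi z') (hay z hx hEx) (hay z' hy hEy)
        (fun j => haS z _ (hEx j)) (fun j => haS z' _ (hEy j)) (fun i j => (hxy i j).2.2.2))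
  have hMm : (M : ℝ) ≤ m := by rw [hm]; exact_mod_cast (hMd.trans hd).trans hdm
  have hMn : (M : ℝ) ≤ n := by rw [hn]; exact_mod_cast (hMd.trans hd).trans hdn
  have hm0 : 0 ≤ m := by positivity
  have hn0 : 0 ≤ n := by positivity
  have hConf : (M : ℝ) * ∑ z, ∑ z', ∑ b, ∑ b', propInd (Conf z z' b b') ≤ 6 * m ^ 2 * n ^ 2 := by
    have hpt : ∀ z z' b b', propInd (Conf z z' b b') ≤ propInd (z = z') + (propInd (b = b') +
        (propInd (ClosedAdj G (z : V) b) + (propInd (E z b ∧ ClosedAdj G (z' : V) (a z b)) +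
        (propInd (E z b ∧ ClosedAdj G (b' : V) (a z b)) +
        propInd (z ≠ z' ∧ E z b ∧ E z' b' ∧ ClosedAdj G (a z b) (a z' b')))))) := by
      intro z z' b b'
      refine (propInd_or_le _ _).trans (add_le_add le_rfl ?_)
      refine (propInd_or_le _ _).trans (add_le_add le_rfl ?_)
      refine (propInd_or_le _ _).trans (add_le_add le_rfl ?_)
      refine (propInd_or_le _ _).trans (add_le_add le_rfl ?_)
      exact propInd_or_le _ _
    have s1 : (M : ℝ) * ∑ z : Z, ∑ z' : Z, ∑ _b : I, ∑ _b' : I, propInd (z = z') ≤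
        m ^ 2 * n ^ 2 := by
      simp only [sum_const, card_univ, nsmul_eq_mul, ← mul_sum, sum_propInd_eq, mul_one]
      rw [← hm, ← hn]
      calc _ = M * (m * n ^ 2) := by ring
        _ ≤ m * (m * n ^ 2) := by gcongr
        _ = _ := by ring
    have s2 : (M : ℝ) * ∑ _z : Z, ∑ _z' : Z, ∑ b : I, ∑ b' : I, propInd (b = b') ≤
        m ^ 2 * n ^ 2 := by
      simp only [sum_const, card_univ, nsmul_eq_mul, sum_propInd_eq, mul_one]
      rw [← hm, ← hn]
      calc _ = M * (m ^ 2 * n) := by ring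
        _ ≤ n * (m ^ 2 * n) := by gcongr
        _ = _ := by ring
    have s3 : (M : ℝ) * ∑ z : Z, ∑ _z' : Z, ∑ b : I, ∑ _b' : I, propInd (ClosedAdj G (z : V) b) ≤
        m ^ 2 * n ^ 2 := by
      simp only [sum_const, card_univ, nsmul_eq_mul, ← mul_sum]
      rw [← hm, ← hn]
      calc _ = m * n * (M * ∑ z : Z, ∑ b : I, propInd (ClosedAdj G (z : V) b)) := by ring
        _ ≤ m * n * (m * n) := by gcongr
        _ = _ := by ring
    have s4 : (M : ℝ) * ∑ z : Z, ∑ z' : Z, ∑ b : I, ∑ _b' : I,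
        propInd (E z b ∧ ClosedAdj G (z' : V) (a z b)) ≤ m ^ 2 * n ^ 2 := by
      simp only [sum_const, card_univ, nsmul_eq_mul, ← mul_sum]
      rw [← hn]
      calc _ = n * ∑ z : Z, (M * ∑ z' : Z, ∑ b : I,
            propInd (E z b ∧ ClosedAdj G (z' : V) (a z b))) := by rw [← mul_sum]; ring
        _ ≤ n * ∑ z : Z, (m * n) := 
          mul_le_mul_of_nonneg_left (sum_le_sum fun z _ => q2 z) hn0
        _ = _ := by simp only [sum_const, card_univ, nsmul_eq_mul]; rw [← hm]; ring
    have s5 : (M : ℝ) * ∑ z : Z, ∑ _z' : Z, ∑ b : I, ∑ b' : I,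
        propInd (E z b ∧ ClosedAdj G (b' : V) (a z b)) ≤ m ^ 2 * n ^ 2 := by
      simp only [sum_const, card_univ, nsmul_eq_mul, ← mul_sum]
      rw [← hm]
      calc _ = m * ∑ z : Z, (M * ∑ b' : I, ∑ b : I,
            propInd (E z b ∧ ClosedAdj G (b' : V) (a z b))) := by
              rw [← mul_sum]
              rw [sum_congr rfl fun z _ => sum_comm]
              ring
        _ ≤ m * ∑ z : Z, (n * n) := 
          mul_le_mul_of_nonneg_left (sum_le_sum fun z _ => q3 z) hm0
        _ = _ := by simp only [sum_const, card_univ, nsmul_eq_mul]; rw [← hm]; ring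
    have s6 : (M : ℝ) * ∑ z : Z, ∑ z' : Z, ∑ b : I, ∑ b' : I,
        propInd (z ≠ z' ∧ E z b ∧ E z' b' ∧ ClosedAdj G (a z b) (a z' b')) ≤ m ^ 2 * n ^ 2 := by
      rw [mul_sum]
      simp_rw [mul_sum (s := (univ : Finset Z))]
      calc _ ≤ ∑ _z : Z, ∑ _z' : Z, (n * n) := 
          sum_le_sum fun z _ => sum_le_sum fun z' _ => q4 z z'
        _ = _ := by simp only [sum_const, card_univ, nsmul_eq_mul]; rw [← hm]; ring
    calc _ ≤ (M : ℝ) * ∑ z : Z, ∑ z' : Z, ∑ b : I, ∑ b' : I, (propInd (z = z') + (propInd (b = b') +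
        (propInd (ClosedAdj G (z : V) b) + (propInd (E z b ∧ ClosedAdj G (z' : V) (a z b)) +
        (propInd (E z b ∧ ClosedAdj G (b' : V) (a z b)) +
        propInd (z ≠ z' ∧ E z b ∧ E z' b' ∧ ClosedAdj G (a z b) (a z' b'))))))) :=
          mul_le_mul_of_nonneg_left (sum_le_sum fun z _ => sum_le_sum fun z' _ =>
            sum_le_sum fun b _ => sum_le_sum fun b' _ => hpt z z' b b') (Nat.cast_nonneg M)
      _ ≤ _ := by
        simp only [sum_add_distrib, mul_add]
        linarith
  obtain ⟨ζ, β, hEζβ, hno⟩ := exists_conflict_free_pattern (s := 2 * k + 2) E Conf (by omega) hE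
    hConf hM
  obtain ⟨o, o', hoo⟩ : ∃ o o' : Fin (2 * k + 2), o ≠ o' :=
    have : Nontrivial (Fin (2 * k + 2)) := Fin.nontrivial_iff_two_le.2 (by omega)
    exists_pair_ne _
  have hother : ∀ i : Fin (2 * k + 2), ∃ i', i ≠ i' := fun i => by
    by_cases h : i = o
    · exact ⟨o', h ▸ hoo⟩
    · exact ⟨o, h⟩
  have hζβ : ∀ i j, ¬ ClosedAdj G (ζ i : V) (β j) := by
    intro i j h
    obtain ⟨i', hi⟩ := hother i
    obtain ⟨j', hj⟩ := hother j
    exact hno i i' j j' hi hj (Or.inr (Or.inr (Or.inl h)))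
  obtain ⟨A, hA⟩ := not_admitsBalancedSeparators_of_pattern (G := G) (k := k)
    (fun i => (ζ i : V)) (fun j => (β j : V)) (fun i j => a (ζ i) (β j))
    (fun i j => haz _ _ (hEζβ i j))
    (fun i j => by
      rcases (hab _ _ (hEζβ i j)).symm with h | h
      · refine absurd (Or.inr ?_) (hζβ i j)
        rw [h]
        exact haz _ _ (hEζβ i j)
      · exact h)
    (fun i i' hi h => by
      rcases h with h | h
      · exact hno i i' o o' hi hoo (Or.inl (Subtype.ext h))
      · exact hind hZi _ (ζ i).2 _ (ζ i').2 h)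
    (fun j j' hj h => by
      rcases h with h | h
      · exact hno o o' j j' hoo hj (Or.inr (Or.inl (Subtype.ext h)))
      · exact hind hIi _ (β j).2 _ (β j').2 h)
    hζβ
    (fun i i' j hi h => by
      obtain ⟨j', hj⟩ := hother j
      exact hno i i' j j' hi hj (Or.inr (Or.inr (Or.inr (Or.inl ⟨hEζβ i j, h⟩)))))
    (fun i j j' hj h => by
      obtain ⟨i', hi⟩ := hother i
      exact hno i i' j j' hi hj (Or.inr (Or.inr (Or.inr (Or.inr (Or.inl ⟨hEζβ i j, h⟩))))))
    (fun i i' j j' hi hj h => hno i i' j j' hi hj (by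
      by_cases hz : ζ i = ζ i'
      · exact Or.inl hz
      · exact Or.inr (Or.inr (Or.inr (Or.inr (Or.inr ⟨hz, hEζβ i j, hEζβ i' j', h⟩))))))
  exact hA (hsep A)

/-- Joining two trees by an edge gives a tree. -/
lemma SimpleGraph.IsTree.sum_sup_edge {σ τ : Type*} [Finite σ] [Finite τ] {S : SimpleGraph σ}
    {T : SimpleGraph τ} (hS : S.IsTree) (hT : T.IsTree) (x : σ) (y : τ) :
    ((S ⊕g T) ⊔ edge (.inl x) (.inr y)).IsTree := by
  classical
  have := Fintype.ofFinite σ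
  have := Fintype.ofFinite τ
  rw [isTree_iff_connected_and_card] at *
  refine ⟨hS.1.sum_sup_edge hT.1, ?_⟩
  rw [Nat.card_eq_fintype_card, ← edgeFinset_card, card_edgeFinset_sup_edge _ (by simp) (by simp),
    edgeFinset_card, ← Nat.card_eq_fintype_card, Nat.card_congr edgeSetSumEquiv, Nat.card_sum,
    Nat.card_sum, ← hS.2, ← hT.2]
  omega

lemma SimpleGraph.Connected.induce_image {σ τ : Type*} {S : SimpleGraph σ} {T : SimpleGraph τ}
    (f : S →g T) {A : Set σ} (h : (S.induce A).Connected) : (T.induce (f '' A)).Connected :=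
  h.map (⟨fun x => ⟨f x, x, x.2, rfl⟩, fun {_ _} hab => f.map_adj hab⟩ :
    S.induce A →g T.induce (f '' A)) (by
      rintro ⟨_, x, hx, rfl⟩
      exact ⟨⟨x, hx⟩, rfl⟩)

/-- The induced subgraph on `U` has a tree-decomposition whose bags are `(m, 2)`-centred in `G`
and one of whose bags contains `Y`. -/
def HasCentredDecompOn {V : Type*} (G : SimpleGraph V) (m : ℕ) (U Y : Set V) : Prop :=
  ∃ (τ : Type) (_ : Fintype τ) (T : SimpleGraph τ) (bag : τ → Set V) (r : τ), T.IsTree ∧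
    (∀ x, bag x ⊆ U) ∧ (∀ u ∈ U, ∀ w ∈ U, G.Adj u w → ∃ x, u ∈ bag x ∧ w ∈ bag x) ∧
    (∀ v ∈ U, (T.induce {x | v ∈ bag x}).Connected) ∧ (∀ x, IsCentred G m 2 (bag x)) ∧ Y ⊆ bag r

namespace HasCentredDecompOn

variable {V : Type*} {G : SimpleGraph V} {m : ℕ} {U Y : Set V}

lemma mono {Y' : Set V} (h : HasCentredDecompOn G m U Y) (hY : Y' ⊆ Y) :
    HasCentredDecompOn G m U Y' := by
  obtain ⟨τ, hτ, T, bag, r, h1, h2, h3, h4, h5, h6⟩ := h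
  exact ⟨τ, hτ, T, bag, r, h1, h2, h3, h4, h5, hY.trans h6⟩

lemma of_isCentred (hU : IsCentred G m 2 U) : HasCentredDecompOn G m U U := by
  refine ⟨Unit, inferInstance, ⊥, fun _ => U, (), .of_subsingleton, fun _ => le_rfl,
    fun u hu w hw _ => ⟨(), hu, hw⟩, fun v hv => ?_, fun _ => hU, le_rfl⟩
  have : Nonempty {x : Unit | v ∈ U} := ⟨⟨(), hv⟩⟩
  exact .of_subsingleton

/-- Two decompositions can be glued along a set contained in a bag of each of them. -/
lemma union {U' Y' : Set V} (h : HasCentredDecompOn G m U Y) (h' : HasCentredDecompOn G m U' Y')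
    (hY : U ∩ U' ⊆ Y ∩ Y') (hadj : ∀ u ∈ U, ∀ w ∈ U', G.Adj u w → u ∈ U' ∨ w ∈ U) :
    HasCentredDecompOn G m (U ∪ U') Y := by
  obtain ⟨σ, hσ, S, b, r, h1, h2, h3, h4, h5, h6⟩ := h
  obtain ⟨τ, hτ, T, b', r', h1', h2', h3', h4', h5', h6'⟩ := h'
  have hu : ∀ u ∈ U, ∀ w ∈ U, G.Adj u w → ∃ x, u ∈ Sum.elim b b' x ∧ w ∈ Sum.elim b b' x :=
    fun u hu w hw huw => (h3 u hu w hw huw).imp' Sum.inl fun _ hx => hx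
  have hu' : ∀ u ∈ U', ∀ w ∈ U', G.Adj u w → ∃ x, u ∈ Sum.elim b b' x ∧ w ∈ Sum.elim b b' x :=
    fun u hu w hw huw => (h3' u hu w hw huw).imp' Sum.inr fun _ hx => hx
  refine ⟨σ ⊕ τ, inferInstance, (S ⊕g T) ⊔ edge (.inl r) (.inr r'), Sum.elim b b', .inl r,
    h1.sum_sup_edge h1' r r', ?_, ?_, ?_, ?_, h6⟩
  · rintro (x | x)
    · exact (h2 x).trans Set.subset_union_left
    · exact (h2' x).trans Set.subset_union_right
  · rintro u (hU | hU) w (hW | hW) huw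
    · exact hu u hU w hW huw
    · rcases hadj u hU w hW huw with h | h
      · exact hu' u h w hW huw
      · exact hu u hU w h huw
    · rcases hadj w hW u hU huw.symm with h | h
      · exact hu' u hU w h huw
      · exact hu u h w hW huw
    · exact hu' u hU w hW huw
  · intro v hv
    set R := (S ⊕g T) ⊔ edge (.inl r) (.inr r') with hR
    have hset : {x | v ∈ Sum.elim b b' x} =
        (Sum.inl '' {x | v ∈ b x} ∪ Sum.inr '' {x | v ∈ b' x} : Set (σ ⊕ τ)) := by
      ext (x | x) <;> simp
    have hl : v ∈ U → (R.induce (Sum.inl '' {x | v ∈ b x})).Connected := fun h =>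
      (h4 v h).induce_image ((Hom.ofLE le_sup_left).comp Embedding.sumInl.toHom)
    have hr : v ∈ U' → (R.induce (Sum.inr '' {x | v ∈ b' x})).Connected := fun h =>
      (h4' v h).induce_image ((Hom.ofLE le_sup_left).comp Embedding.sumInr.toHom)
    rw [hset]
    by_cases hU : v ∈ U
    · by_cases hU' : v ∈ U'
      · refine connected_induce_union (v := .inl r) (w := .inr r') (hl hU).preconnected
          (hr hU').preconnected ⟨r, h6 (hY ⟨hU, hU'⟩).1, rfl⟩ ⟨r', h6' (hY ⟨hU, hU'⟩).2, rfl⟩ ?_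
        simp [hR, edge_adj]
      · have : {x | v ∈ b' x} = ∅ := Set.eq_empty_of_forall_notMem fun x hx => hU' (h2' x hx)
        rw [this, Set.image_empty, Set.union_empty]
        exact hl hU
    · have : {x | v ∈ b x} = ∅ := Set.eq_empty_of_forall_notMem fun x hx => hU (h2 x hx)
      rw [this, Set.image_empty, Set.empty_union]
      exact hr (hv.resolve_left hU)
  · rintro (x | x)
    · exact h5 x
    · exact h5' x

/-- Decompositions of several parts can be attached to a common bag `B`. -/
lemma union_iUnion {ι : Type*} [Finite ι] {B : Set V} {U Y : ι → Set V}
    (hB : IsCentred G m 2 B) (h : ∀ i, HasCentredDecompOn G m (U i) (Y i))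
    (hY : ∀ i, B ∩ U i ⊆ Y i) (hU : ∀ i j, i ≠ j → U i ∩ U j ⊆ B)
    (hadj : ∀ i, ∀ u ∈ B ∪ ⋃ j, U j, ∀ w ∈ U i, G.Adj u w → u ∈ U i ∨ w ∈ B) :
    HasCentredDecompOn G m (B ∪ ⋃ i, U i) B := by
  classical
  have := Fintype.ofFinite ι
  suffices ∀ s : Finset ι, HasCentredDecompOn G m (B ∪ ⋃ i ∈ s, U i) B by
    simpa using this Finset.univ
  intro s
  induction s using Finset.induction_on with
  | empty => simpa using of_isCentred hB
  | insert i s his ih =>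
    have hBi : (B ∪ ⋃ j ∈ s, U j) ∩ U i ⊆ B := by
      rintro v ⟨hv | hv, hvi⟩
      · exact hv
      · obtain ⟨j, hj, hvj⟩ := Set.mem_iUnion₂.1 hv
        exact hU j i (fun h => his (h ▸ hj)) ⟨hvj, hvi⟩
    have heq : B ∪ ⋃ j ∈ insert i s, U j = (B ∪ ⋃ j ∈ s, U j) ∪ U i := by
      rw [Finset.set_biUnion_insert, Set.union_comm (U i), Set.union_assoc]
    rw [heq]
    refine ih.union (h i) (fun v hv => ⟨hBi hv, hY i ⟨hBi hv, hv.2⟩⟩) fun u hu w hw huw => ?_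
    refine (hadj i u ?_ w hw huw).imp_right Or.inl
    exact Set.union_subset_union_right B (Set.iUnion₂_subset_iUnion _ _) hu

end HasCentredDecompOn

lemma subset_ballAround_one {V : Type*} {G : SimpleGraph V} (S : Set V) : S ⊆ ballAround G S 1 :=
  fun v hv => mem_ballAround_one.2 ⟨v, hv, Or.inl rfl⟩

lemma ballAround_mono {V : Type*} {G : SimpleGraph V} {S S' : Set V} (h : S ⊆ S') (r : ℕ) :
    ballAround G S r ⊆ ballAround G S' r :=
  fun _ ⟨u, hu, huv⟩ => ⟨u, h hu, huv⟩

lemma ClosedAdj.edist_le_one {V : Type*} {G : SimpleGraph V} {x y : V} (h : ClosedAdj G x y) :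
    G.edist x y ≤ 1 :=
  edist_le_one_iff_adj_or_eq.2 (or_comm.1 h)

section Decomposition

variable {V : Type*} [Finite V] {G : SimpleGraph V}

lemma isCentred_of_subset_ballAround {m : ℕ} {Y W : Set V} (hY : indepNumOn G Y ≤ m)
    (hW : W ⊆ ballAround G Y 1) : IsCentred G m 2 W := by
  obtain ⟨I, hIY, hi, hc⟩ := exists_ncard_eq_indepNumOn G Y
  refine ⟨I, hc.trans_le hY, fun v hv => ?_⟩
  obtain ⟨u, hu, huv⟩ := mem_ballAround_one.1 (hW hv)
  obtain ⟨i, hiI, hiu⟩ := exists_closedAdj_of_ncard_eq hIY hi hc hu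
  refine ⟨i, hiI, G.edist_triangle.trans ((add_le_add hiu.edist_le_one huv.edist_le_one).trans ?_)⟩
  norm_num

lemma exists_superset_indepNumOn_eq {X U : Set V} {n : ℕ} (hXU : X ⊆ U) (hX : indepNumOn G X ≤ n)
    (hU : n ≤ indepNumOn G U) : ∃ X', X ⊆ X' ∧ X' ⊆ U ∧ indepNumOn G X' = n := by
  obtain ⟨X', ⟨h1, h2, h3⟩, hmax⟩ := Set.exists_max_image
    {X' : Set V | X ⊆ X' ∧ X' ⊆ U ∧ indepNumOn G X' ≤ n} Set.ncard (Set.toFinite _)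
    ⟨X, le_rfl, hXU, hX⟩
  refine ⟨X', h1, h2, h3.antisymm (not_lt.1 fun hlt => ?_)⟩
  obtain ⟨v, hvU, hv⟩ : ∃ v ∈ U, v ∉ X' := by
    by_contra! hcon
    exact absurd (indepNumOn_mono (G := G) hcon) (by omega)
  have h4 : indepNumOn G (insert v X') ≤ n := by
    have h5 := indepNumOn_union_le (G := G) {v} X'
    have h6 := indepNumOn_le_ncard (G := G) {v}
    rw [Set.ncard_singleton] at h6
    rw [Set.insert_eq]
    omega
  have h5 := hmax (insert v X') ⟨h1.trans (Set.subset_insert _ _), Set.insert_subset hvU h2, h4⟩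
  rw [Set.ncard_insert_of_notMem hv] at h5
  omega

/-- Vertices that see only small independent subsets of `X` together dominate only a small
independent subset of `X`. -/
lemma two_mul_indepNumOn_dominated_le {d : ℕ} (hd : 2 ≤ d) {X S Z : Set V}
    (hZ : ∀ z ∈ Z, 2 * indepNumOn G (G.neighborSet z ∩ X) ≤ d)
    (hS : ∀ v ∈ S, ∃ z ∈ Z, ClosedAdj G z v) : 2 * indepNumOn G (X ∩ S) ≤ Z.ncard * d := by
  classical
  have := Fintype.ofFinite V
  obtain ⟨T, hT, hTi, hTc⟩ := exists_ncard_eq_indepNumOn G (X ∩ S)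
  have h1 : ∀ z ∈ Z, (T ∩ {v | ClosedAdj G z v}).ncard ≤ d / 2 := by
    intro z hz
    by_cases hzT : z ∈ T
    · have : T ∩ {v | ClosedAdj G z v} ⊆ {z} := by
        rintro v ⟨hv, rfl | hzv⟩
        · rfl
        · exact absurd hzv (hTi hzT hv hzv.ne)
      have := Set.ncard_le_ncard this
      rw [Set.ncard_singleton] at this
      omega
    · have h2 := ncard_le_indepNumOn (G := G) (Y := G.neighborSet z ∩ X)
        (s := T ∩ {v | ClosedAdj G z v}) (by
          rintro v ⟨hv, rfl | hzv⟩
          · exact absurd hv hzT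
          · exact ⟨hzv, (hT hv).1⟩) (hTi.mono Set.inter_subset_left)
      have := hZ z hz
      omega
  have h3 : T.ncard ≤ Z.ncard * (d / 2) := by
    rw [Set.ncard_eq_toFinset_card' T, Set.ncard_eq_toFinset_card' Z]
    refine (Finset.card_le_card (t := Z.toFinset.biUnion fun z =>
      (T ∩ {v | ClosedAdj G z v}).toFinset) fun v hv => ?_).trans
      (Finset.card_biUnion_le_card_mul _ _ _ fun z hz => ?_)
    · rw [Set.mem_toFinset] at hv
      obtain ⟨z, hz, hzv⟩ := hS v (hT hv).2
      exact Finset.mem_biUnion.2 ⟨z, by simpa using hz, by simpa using ⟨hv, hzv⟩⟩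
    · rw [← Set.ncard_eq_toFinset_card']
      exact h1 z (by simpa using hz)
  rw [← hTc]
  calc 2 * T.ncard ≤ 2 * (Z.ncard * (d / 2)) := Nat.mul_le_mul_left _ h3
    _ = Z.ncard * (2 * (d / 2)) := by ring
    _ ≤ Z.ncard * d := Nat.mul_le_mul_left _ (by omega)

/-- A part of `R` without edges to the rest of `R` contains only a small independent subset of
`X`, if it contains at most half of a maximum one. -/
lemma indepNumOn_inter_add_le {X I R C : Set V} (hIX : I ⊆ X) (hIi : G.IsIndepSet I)
    (hIc : I.ncard = indepNumOn G X) (hC : ∀ u ∈ R \ C, ∀ v ∈ C, ¬ ClosedAdj G u v) :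
    indepNumOn G (X ∩ C) ≤ (I \ R).ncard + (I ∩ C).ncard := by
  obtain ⟨J, hJ, hJi, hJc⟩ := exists_ncard_eq_indepNumOn G (X ∩ C)
  have hno : ∀ u ∈ I ∩ (R \ C), ∀ v ∈ J, ¬ ClosedAdj G u v :=
    fun u hu v hv => hC u hu.2 v (hJ hv).2
  have h1 := ncard_le_indepNumOn (G := G) (Y := X) (s := I ∩ (R \ C) ∪ J)
    (Set.union_subset (Set.inter_subset_left.trans hIX) (hJ.trans Set.inter_subset_left)) (by
      refine Set.pairwise_union.2 ⟨hIi.mono Set.inter_subset_left, hJi,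
        fun a ha b hb _ => ⟨?_, ?_⟩⟩
      · exact fun h => hno a ha b hb (Or.inr h)
      · exact fun h => hno a ha b hb (Or.inr h.symm))
  rw [Set.ncard_union_eq (Set.disjoint_left.2 fun u hu hu' => hno u hu u hu' (Or.inl rfl))
    (Set.toFinite _) (Set.toFinite _)] at h1
  have h2 : I ⊆ I ∩ (R \ C) ∪ (I \ R ∪ I ∩ C) := by
    intro v hv
    by_cases h : v ∈ C
    · exact Or.inr (Or.inr ⟨hv, h⟩)
    · by_cases h' : v ∈ R
      · exact Or.inl ⟨hv, h', h⟩
      · exact Or.inr (Or.inl ⟨hv, h'⟩)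
  have h3 := Set.ncard_le_ncard h2 (Set.toFinite _)
  have h4 := Set.ncard_union_le (I ∩ (R \ C)) (I \ R ∪ I ∩ C)
  have h5 := Set.ncard_union_le (I \ R) (I ∩ C)
  omega

/-- The recursive construction: if the vertices with large independence number towards any
critical set `X` have small independence number, the graph has a tree-decomposition with centred
bags. -/
lemma hasCentredDecompOn_of_high_degree_le {k d : ℕ} (hk : 1 ≤ k) (hd : 2 ≤ d)
    (hsep : ∀ A : Set V, AdmitsBalancedSeparators (G.induce A) k 1)
    (hhigh : ∀ X L : Set V, indepNumOn G X = 10 * d * k →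
      (∀ z ∈ L, d ≤ 2 * indepNumOn G (G.neighborSet z ∩ X)) → indepNumOn G L ≤ d) :
    ∀ (n : ℕ) (U X : Set V), U.ncard ≤ n → X ⊆ U → indepNumOn G X ≤ 10 * d * k →
      HasCentredDecompOn G (20 * d * k) U (ballAround G X 1 ∩ U) := by
  intro n
  induction n using Nat.strong_induction_on with
  | _ n ih =>
  intro U X₀ hUn hXU₀ hX₀
  have hdk : d ≤ d * k := Nat.le_mul_of_pos_right d hk
  have hkd : 2 * k ≤ d * k := Nat.mul_le_mul_right k hd
  have e10 : 10 * d * k = 10 * (d * k) := by ring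
  have e20 : 20 * d * k = 20 * (d * k) := by ring
  rcases le_total (indepNumOn G U) (10 * d * k) with hU | hU
  · exact (HasCentredDecompOn.of_isCentred (isCentred_of_subset_ballAround (by omega)
      (subset_ballAround_one U))).mono Set.inter_subset_right
  obtain ⟨X, hXX, hXU, hX⟩ := exists_superset_indepNumOn_eq hXU₀ hX₀ hU
  suffices HasCentredDecompOn G (20 * d * k) U (ballAround G X 1 ∩ U) from
    this.mono (Set.inter_subset_inter_left _ (ballAround_mono hXX 1))
  set L : Set V := {v ∈ U | d ≤ 2 * indepNumOn G (G.neighborSet v ∩ X)} with hL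
  have hLd : indepNumOn G L ≤ d := hhigh X L hX fun z hz => hz.2
  obtain ⟨I, hIX, hIi, hIc⟩ := exists_ncard_eq_indepNumOn G X
  obtain ⟨Z, hZU, hZk, hZ⟩ := (hsep (U \ L)).exists_centres (I := I \ L)
    (Set.sdiff_subset_sdiff_left (hIX.trans hXU))
  set S : Set V := {v ∈ U \ L | ∃ z ∈ Z, ClosedAdj G z v} with hS
  set R : Set V := {v ∈ U \ L | ∀ z ∈ Z, ¬ ClosedAdj G z v} with hR
  have hcover : ∀ v ∈ U, v ∈ R ∨ v ∈ S ∨ v ∈ L := by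
    intro v hv
    by_cases h1 : v ∈ L
    · exact Or.inr (Or.inr h1)
    · by_cases h2 : ∃ z ∈ Z, ClosedAdj G z v
      · exact Or.inr (Or.inl ⟨⟨hv, h1⟩, h2⟩)
      · push Not at h2
        exact Or.inl ⟨⟨hv, h1⟩, h2⟩
  let C : (G.induce R).ConnectedComponent → Set V := fun c => Subtype.val '' c.supp
  have hCR : ∀ c, C c ⊆ R := by rintro c _ ⟨v, -, rfl⟩; exact v.2
  have hCC : ∀ c, (G.induce (C c)).Connected := fun c =>
    c.connected_toSimpleGraph.induce_image (Embedding.induce R).toHom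
  have hCadj : ∀ c, ∀ u ∈ R, ∀ v ∈ C c, ClosedAdj G u v → u ∈ C c := by
    rintro c u hu _ ⟨v, hv, rfl⟩ (rfl | huv)
    · exact ⟨v, hv, rfl⟩
    · refine ⟨⟨u, hu⟩, ?_, rfl⟩
      rw [ConnectedComponent.mem_supp_iff] at hv ⊢
      rw [← hv]
      exact ConnectedComponent.sound (Adj.reachable huv)
  have hCdisj : ∀ c c', c ≠ c' → Disjoint (C c) (C c') := by
    rintro c c' hcc
    refine Set.disjoint_left.2 ?_
    rintro _ ⟨v, hv, rfl⟩ ⟨v', hv', hvv⟩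
    obtain rfl := Subtype.ext hvv
    exact hcc (hv.symm.trans hv')
  have hCcover : ∀ v ∈ R, ∃ c, v ∈ C c := fun v hv =>
    ⟨(G.induce R).connectedComponentMk ⟨v, hv⟩, ⟨v, hv⟩, rfl, rfl⟩
  set B : Set V := ballAround G (X ∪ (L ∪ Z)) 1 ∩ U with hB
  have hBX : ballAround G X 1 ∩ U ⊆ B :=
    Set.inter_subset_inter_left _ (ballAround_mono Set.subset_union_left 1)
  have hZα : indepNumOn G Z ≤ k := (indepNumOn_le_ncard Z).trans hZk
  have hBc : IsCentred G (20 * d * k) 2 B := by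
    refine isCentred_of_subset_ballAround (Y := X ∪ (L ∪ Z)) ?_ Set.inter_subset_left
    have h1 := indepNumOn_union_le (G := G) X (L ∪ Z)
    have h2 := indepNumOn_union_le (G := G) L Z
    omega
  have hLB : L ⊆ B := fun v hv =>
    ⟨subset_ballAround_one _ (Or.inr (Or.inl hv)), hv.1⟩
  have hSB : S ⊆ B := by
    rintro v ⟨hv, z, hz, hzv⟩
    exact ⟨mem_ballAround_one.2 ⟨z, Or.inr (Or.inr hz), hzv⟩, hv.1⟩
  have hSL : S ∪ L ⊆ B := Set.union_subset hSB hLB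
  have hUpart : ∀ c, C c ∪ (S ∪ L) ⊆ U := fun c =>
    Set.union_subset (fun v hv => (hCR c hv).1.1) (hSL.trans Set.inter_subset_right)
  have hnbr : ∀ c, ∀ u ∈ U, ∀ v ∈ C c, ClosedAdj G u v → u ∈ C c ∪ (S ∪ L) := by
    intro c u hu v hv huv
    rcases hcover u hu with h | h
    · exact Or.inl (hCadj c u h v hv huv)
    · exact Or.inr h
  have hBU : B ∪ ⋃ c, (C c ∪ (S ∪ L)) = U := by
    refine Set.Subset.antisymm
      (Set.union_subset Set.inter_subset_right (Set.iUnion_subset hUpart)) fun v hv => ?_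
    rcases hcover v hv with h | h
    · obtain ⟨c, hc⟩ := hCcover v h
      exact Or.inr (Set.mem_iUnion.2 ⟨c, Or.inl hc⟩)
    · exact Or.inl (hSL h)
  let X' : (G.induce R).ConnectedComponent → Set V := fun c => X ∩ C c ∪ (X ∩ S ∪ (L ∪ Z))
  have hX'α : ∀ c, indepNumOn G (X' c) < 10 * d * k := by
    intro c
    have h1 := indepNumOn_union_le (G := G) (X ∩ C c) (X ∩ S ∪ (L ∪ Z))
    have h2 := indepNumOn_union_le (G := G) (X ∩ S) (L ∪ Z)
    have h3 := indepNumOn_union_le (G := G) L Z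
    have h4 : 2 * indepNumOn G (X ∩ S) ≤ Z.ncard * d :=
      two_mul_indepNumOn_dominated_le hd
        (fun z hz => by
          have : z ∉ L := (hZU hz).2
          by_contra! hcon
          exact this ⟨(hZU hz).1, hcon.le⟩)
        fun v hv => hv.2
    have h5 : Z.ncard * d ≤ d * k := by
      rw [mul_comm]; exact Nat.mul_le_mul_left _ hZk
    have h6 := indepNumOn_inter_add_le (C := C c) (R := R) hIX hIi hIc
      fun u hu v hv huv => hu.2 (hCadj c u hu.1 v hv huv)
    have h7 : 2 * (I ∩ C c).ncard ≤ 10 * d * k := by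
      have h8 := hZ (C c) (fun v hv => (hCR c hv).1) (fun z hz v hv => (hCR c hv).2 z hz)
        (hCC c).preconnected
      have h9 : I ∩ C c = I \ L ∩ C c := by
        ext v
        exact ⟨fun h => ⟨⟨h.1, (hCR c h.2).1.2⟩, h.2⟩, fun h => ⟨h.1.1, h.2⟩⟩
      have h10 := Set.ncard_le_ncard (Set.sdiff_subset : I \ L ⊆ I) (Set.toFinite _)
      rw [h9]
      omega
    have h8 : (I \ R).ncard ≤ indepNumOn G (X ∩ S) + indepNumOn G L := by
      have h9 : I \ R ⊆ I ∩ S ∪ I ∩ L := by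
        rintro v ⟨hv, hvR⟩
        rcases hcover v (hXU (hIX hv)) with h | h | h
        · exact absurd h hvR
        · exact Or.inl ⟨hv, h⟩
        · exact Or.inr ⟨hv, h⟩
      have h10 := Set.ncard_le_ncard h9 (Set.toFinite _)
      have h11 := Set.ncard_union_le (I ∩ S) (I ∩ L)
      have h12 := ncard_le_indepNumOn (G := G) (Y := X ∩ S) (s := I ∩ S)
        (Set.inter_subset_inter_left _ hIX) (hIi.mono Set.inter_subset_left)
      have h13 := ncard_le_indepNumOn (G := G) (Y := L) (s := I ∩ L)
        Set.inter_subset_right (hIi.mono Set.inter_subset_left)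
      omega
    change indepNumOn G (X ∩ C c ∪ (X ∩ S ∪ (L ∪ Z))) < _
    omega
  have hlt : ∀ c, (C c ∪ (S ∪ L)).ncard < U.ncard := by
    intro c
    refine Set.ncard_lt_ncard ((hUpart c).ssubset_of_ne fun heq => ?_) (Set.toFinite _)
    refine absurd (indepNumOn_mono (G := G) (fun v hv => ?_ : X ⊆ X' c)) (by have := hX'α c; omega)
    rcases heq.ge (hXU hv) with h | h | h
    · exact Or.inl ⟨hv, h⟩
    · exact Or.inr (Or.inl ⟨hv, h⟩)
    · exact Or.inr (Or.inr (Or.inl h))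
  have hZS : Z ⊆ S := fun z hz => ⟨hZU hz, z, hz, Or.inl rfl⟩
  have hX'sub : ∀ c, X' c ⊆ C c ∪ (S ∪ L) := by
    rintro c v (h | h | h | h)
    · exact Or.inl h.2
    · exact Or.inr (Or.inl h.2)
    · exact Or.inr (Or.inr h)
    · exact Or.inr (Or.inl (hZS h))
  have hmain := HasCentredDecompOn.union_iUnion hBc
    (fun c => ih (C c ∪ (S ∪ L)).ncard ((hlt c).trans_le hUn) (C c ∪ (S ∪ L)) (X' c) le_rfl
      (hX'sub c) (hX'α c).le) ?_ ?_ ?_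
  · rw [hBU] at hmain
    exact hmain.mono hBX
  · rintro c v ⟨⟨hvB, hvU⟩, hv⟩
    refine ⟨mem_ballAround_one.2 ?_, hv⟩
    obtain ⟨u, hu, huv⟩ := mem_ballAround_one.1 hvB
    rcases hv with hv | hv | hv
    · rcases hu with hu | hu
      · refine ⟨u, ?_, huv⟩
        rcases hnbr c u (hXU hu) v hv huv with h | h | h
        · exact Or.inl ⟨hu, h⟩
        · exact Or.inr (Or.inl ⟨hu, h⟩)
        · exact Or.inr (Or.inr (Or.inl h))
      · exact ⟨u, Or.inr (Or.inr hu), huv⟩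
    · obtain ⟨z, hz, hzv⟩ := hv.2
      exact ⟨z, Or.inr (Or.inr (Or.inr hz)), hzv⟩
    · exact ⟨v, Or.inr (Or.inr (Or.inl hv)), Or.inl rfl⟩
  · rintro c c' hcc v ⟨hv | hv, hv'⟩
    · rcases hv' with hv' | hv'
      · exact absurd hv' (Set.disjoint_left.1 (hCdisj c c' hcc) hv)
      · exact hSL hv'
    · exact hSL hv
  · rintro c u hu w (hw | hw) huw
    · rw [hBU] at hu
      exact Or.inl (hnbr c u hu w hw (Or.inr huw))
    · exact Or.inr (hSL hw)

end Decomposition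

/-- The numerical estimate relating the Kővári–Sós–Turán threshold to the size bound. -/
lemma pow_mul_sq_le_pow_pow {k t : ℕ} (hk : 1 ≤ k) (ht : 2 ≤ t) :
    (7 * (2 * k + 2) ^ 4 * (20 * k) ^ ((2 * k + 2) * (2 * k + 2))) ^ t * t ^ 2 ≤
      (512 * (20 * k)) ^ ((2 * k + 2) ^ (2 * t)) := by
  generalize hs : 2 * k + 2 = s
  generalize hq : 20 * k = q
  have hs4 : 4 ≤ s := by omega
  have h1 : 7 * s ^ 4 ≤ 512 ^ (s * s) :=
    calc 7 * s ^ 4 ≤ 2 ^ 3 * (2 ^ s) ^ 4 :=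
          Nat.mul_le_mul (by norm_num) (Nat.pow_le_pow_left Nat.lt_two_pow_self.le 4)
      _ = 2 ^ (3 + s * 4) := by rw [← pow_mul, ← pow_add]
      _ ≤ 2 ^ (9 * (s * s)) := Nat.pow_le_pow_right (by norm_num) (by nlinarith)
      _ = 512 ^ (s * s) := by rw [pow_mul]; norm_num
  have h2 : 7 * s ^ 4 * q ^ (s * s) ≤ (512 * q) ^ (s * s) := by
    rw [mul_pow]
    exact Nat.mul_le_mul_right _ h1
  have h3 : t ^ 2 ≤ (512 * q) ^ t :=
    calc t ^ 2 ≤ (2 ^ t) ^ 2 := Nat.pow_le_pow_left Nat.lt_two_pow_self.le 2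
      _ = (2 ^ 2) ^ t := by rw [← pow_mul, ← pow_mul, mul_comm]
      _ ≤ (512 * q) ^ t := Nat.pow_le_pow_left (by omega) t
  have h4 : s * s * t + t ≤ s ^ (2 * t) := by
    rw [pow_mul, sq]
    have h16 : 16 ≤ s * s := Nat.mul_le_mul hs4 hs4
    generalize s * s = r at h16
    clear h3
    induction t, ht using Nat.le_induction with
    | base => nlinarith
    | succ t ht ih =>
      have h5 : r * t + t ≥ r + 1 := by nlinarith
      rw [pow_succ]
      nlinarith [Nat.mul_le_mul ih h16]
  calc (7 * s ^ 4 * q ^ (s * s)) ^ t * t ^ 2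
      ≤ ((512 * q) ^ (s * s)) ^ t * (512 * q) ^ t :=
        Nat.mul_le_mul (Nat.pow_le_pow_left h2 t) h3
    _ = (512 * q) ^ (s * s * t + t) := by rw [← pow_mul, ← pow_add]
    _ ≤ (512 * q) ^ (s ^ (2 * t)) := Nat.pow_le_pow_right (by omega) h4

lemma isEmpty_of_admitsBalancedSeparators_zero {V : Type*} [Finite V] {G : SimpleGraph V}
    (h : AdmitsBalancedSeparators (G.induce Set.univ) 0 1) : IsEmpty V := by
  refine ⟨fun v => ?_⟩
  obtain ⟨T, -, hT, hD⟩ := h.exists_centres (I := {v}) (Set.subset_univ _)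
  rw [Nat.le_zero, Set.ncard_eq_zero (Set.toFinite T)] at hT
  have := hD {v} (Set.subset_univ _) (by simp [hT]) .of_subsingleton
  simp at this

/-- Main technical lemma: with `d = (512 · 20k)^{(2k+2)^{2t}}`, if `G` is `K_{t,t}`-free and
every induced subgraph of `G` admits `(k, 1)`-balanced separators, then for every `X` with
`α(X) ≤ 10dk` there is a `(20dk, 2)`-centred tree-decomposition of `G` with a bag
containing `N[X]`. -/
theorem main_technical_lemma (k t : ℕ) {V : Type} [Fintype V] (G : SimpleGraph V)
    (hKtt : IsEmpty (completeBipartiteGraph (Fin t) (Fin t) ↪g G))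
    (hsep : ∀ A : Set V, AdmitsBalancedSeparators (G.induce A) k 1)
    (X : Set V)
    (hX : indepNumOn G X ≤ 10 * (512 * (20 * k)) ^ ((2 * k + 2) ^ (2 * t)) * k) :
    ∃ (τ : Type) (_ : Fintype τ) (D : TreeDecomp G τ),
      (∀ x : τ, IsCentred G (20 * (512 * (20 * k)) ^ ((2 * k + 2) ^ (2 * t)) * k) 2 (D.bag x)) ∧
      ∃ x : τ, ballAround G X 1 ⊆ D.bag x := by
  suffices HasCentredDecompOn G (20 * (512 * (20 * k)) ^ ((2 * k + 2) ^ (2 * t)) * k) Set.univ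
      (ballAround G X 1 ∩ Set.univ) by
    obtain ⟨τ, hτ, T, bag, r, h1, -, h3, h4, h5, h6⟩ := this
    refine ⟨τ, hτ, ⟨T, h1, bag, fun u w huw => h3 u trivial w trivial huw, fun v => ?_,
      fun v => h4 v trivial⟩, h5, r, by simpa using h6⟩
    obtain ⟨x⟩ := (h4 v trivial).nonempty
    exact ⟨x, x.2⟩
  rcases Nat.eq_zero_or_pos k with rfl | hk
  · have := isEmpty_of_admitsBalancedSeparators_zero (hsep Set.univ)
    exact (HasCentredDecompOn.of_isCentred ⟨∅, by simp, fun v => this.elim v⟩).mono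
      Set.inter_subset_right
  have hd : 2 ≤ (512 * (20 * k)) ^ ((2 * k + 2) ^ (2 * t)) :=
    (by omega : 2 ≤ 512 * (20 * k)).trans (Nat.le_self_pow (by positivity) _)
  refine hasCentredDecompOn_of_high_degree_le hk hd hsep ?_ _ _ X le_rfl (Set.subset_univ _) hX
  intro Y L hY hL
  obtain ht | rfl | rfl : 2 ≤ t ∨ t = 1 ∨ t = 0 := by omega
  · refine (indepNumOn_high_degree_lt ht hk ?_ (pow_mul_sq_le_pow_pow hk ht) hKtt hsep hY hL).le
    have : 0 < (2 * k + 2) ^ 4 * (20 * k) ^ ((2 * k + 2) * (2 * k + 2)) := by positivity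
    rw [mul_assoc, mul_assoc]
    omega
  · have hG : ∀ u v, ¬ G.Adj u v := fun u v huv =>
      not_isEmpty_embedding_of_adj (x := fun _ : Fin 1 => u) (y := fun _ => v)
        (Function.injective_of_subsingleton _) (Function.injective_of_subsingleton _)
        (fun _ _ => G.irrefl) (fun _ _ => G.irrefl) (fun _ _ => huv) hKtt
    have hLe : L = ∅ := Set.eq_empty_of_forall_notMem fun z hz => by
      have h1 := hL z hz
      have h2 : G.neighborSet z = ∅ := Set.eq_empty_of_forall_notMem fun v hv => hG z v hv
      have h3 := indepNumOn_le_ncard (G := G) (∅ : Set V)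
      rw [h2, Set.empty_inter] at h1
      rw [Set.ncard_empty] at h3
      omega
    have := indepNumOn_le_ncard (G := G) (∅ : Set V)
    rw [Set.ncard_empty] at this
    rw [hLe]
    omega
  · exact absurd hKtt (not_isEmpty_embedding_of_adj (x := Fin.elim0) (y := Fin.elim0)
      (Function.injective_of_subsingleton _) (Function.injective_of_subsingleton _)
      (fun i => i.elim0) (fun i => i.elim0) (fun i => i.elim0))
end
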